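/- arXiv:2012.12818 — 2 statements merged into one kernel-verified Lean document; each statement's English description precedes it below -/
import Mathlib

section
/- For every real number δ > 0 there exists a natural number N₂(δ) with the following property: for every integer d ≥ N₂(δ) and every finite permutation group G ≤ Sym(Ω) of degree n = |Ω| such that the point stabilizer G_α lies in the class Γ_d for every α ∈ Ω, one has |G| ≤ ((1+δ)·d/e)^{n-1}, where e denotes Euler's number. -/
open scoped Pointwise

/-- A group `H` has a *section* isomorphic to the alternating group `A_d`, i.e. there are
subgroups `K ⊴ L ≤ H` with `L/K ≅ A_d`; equivalently, there is a subgroup `L ≤ H` and a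
surjective homomorphism from `L` onto `A_d`. -/
def HasAltSection (d : ℕ) (H : Type*) [Group H] : Prop :=
  ∃ (L : Subgroup H) (φ : ↥L →* alternatingGroup (Fin d)), Function.Surjective φ

/-- The class `Γ_d`: groups with no section isomorphic to the alternating group `A_d`. -/
def InGamma (d : ℕ) (H : Type*) [Group H] : Prop := ¬ HasAltSection d H

/-- A permutation group `G ≤ Sym(Ω)` is primitive if it acts transitively on `Ω` and
every block of the action is trivial (i.e. it preserves no nontrivial partition of `Ω`). -/
def IsPrimitivePerm {Ω : Type*} (G : Subgroup (Equiv.Perm Ω)) : Prop :=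
  MulAction.IsPretransitive G Ω ∧
    ∀ B : Set Ω, MulAction.IsBlock G B → MulAction.IsTrivialBlock B

/-- `G ≤ Sym(Ω)` has a base of size at most `k`: a subset of `Ω` of cardinality at most `k`
whose pointwise stabilizer in `G` is trivial.  The base size `b(G)` is the least such `k`,
so `b(G) ≤ k` is expressed by `HasBaseOfSize G k`. -/
def HasBaseOfSize {Ω : Type*} (G : Subgroup (Equiv.Perm Ω)) (k : ℕ) : Prop :=
  ∃ S : Finset Ω, S.card ≤ k ∧ ∀ g ∈ G, (∀ α ∈ S, g α = α) → g = 1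

/-- The pointwise stabilizer `G_(Δ) = ⋂_{α ∈ Δ} G_α` of a subset `Δ ⊆ Ω` in `G ≤ Sym(Ω)`,
as a subgroup of `G` (equal to `G` itself when `Δ` is empty). -/
def PointwiseStab {Ω : Type*} (G : Subgroup (Equiv.Perm Ω)) (Δ : Finset Ω) : Subgroup ↥G :=
  ⨅ α ∈ Δ, MulAction.stabilizer (↥G) α

open MulAction

namespace InGamma

variable {d : ℕ} {G H : Type*} [Group G] [Group H]

theorem of_injective (h : InGamma d H) (f : G →* H) (hf : Function.Injective f) : InGamma d G := by
  rintro ⟨L, φ, hφ⟩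
  have e := (L.equivMapOfInjective f hf).symm
  exact h ⟨L.map f, φ.comp e.toMonoidHom, hφ.comp e.surjective⟩

theorem subgroup (h : InGamma d G) (K : Subgroup G) : InGamma d K :=
  h.of_injective K.subtype K.subtype_injective

theorem of_surjective (h : InGamma d G) (f : G →* H) (hf : Function.Surjective f) :
    InGamma d H := by
  rintro ⟨L, φ, hφ⟩
  refine h ⟨L.comap f, φ.comp (f.subgroupComap L), hφ.comp ?_⟩
  rintro ⟨y, hy⟩
  obtain ⟨x, rfl⟩ := hf y
  exact ⟨⟨x, hy⟩, rfl⟩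

theorem not_alternatingGroup_le {Ω : Type*} [Fintype Ω] [DecidableEq Ω]
    {G : Subgroup (Equiv.Perm Ω)} (h : InGamma d G) (hd : d ≤ Fintype.card Ω) :
    ¬ alternatingGroup Ω ≤ G := by
  intro hle
  obtain ⟨e⟩ : Nonempty (Fin d ↪ Ω) := Function.Embedding.nonempty_of_card_le (by simpa using hd)
  let f : alternatingGroup (Fin d) →* Equiv.Perm Ω :=
    (Equiv.Perm.viaEmbeddingHom e).comp (alternatingGroup (Fin d)).subtype
  have hf : Function.Injective f :=
    (Equiv.Perm.viaEmbeddingHom_injective e).comp (Subgroup.subtype_injective _)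
  have hG : ∀ x, f x ∈ G := fun x ↦ hle <| by
    have : Equiv.Perm.sign (f x) = Equiv.Perm.sign (x : Equiv.Perm (Fin d)) := by
      classical
      exact @Equiv.Perm.sign_extendDomain _ _ _ _ _ _ _ _ (fun _ ↦ Classical.propDecidable _) _
    rw [Equiv.Perm.mem_alternatingGroup, this]
    exact x.2
  have h' := h.of_injective (f.codRestrict G hG) (fun x y hxy ↦ hf (congrArg Subtype.val hxy))
  exact h' ⟨⊤, (Subgroup.topEquiv (G := alternatingGroup (Fin d))).toMonoidHom,
    Subgroup.topEquiv.surjective⟩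

end InGamma

/-- Every permutation group of degree `m` in `Γ_d` has order at most `B`. -/
def DegreeBound (d m : ℕ) (B : ℝ) : Prop :=
  ∀ H : Subgroup (Equiv.Perm (Fin m)), InGamma d H → (Nat.card H : ℝ) ≤ B

section Actions

variable {d : ℕ} {G Ω : Type*} [Group G] [MulAction G Ω]

theorem DegreeBound.card_le_mul_card_ker [Fintype Ω] {B : ℝ}
    (hB : DegreeBound d (Fintype.card Ω) B) (hG : InGamma d G) :
    (Nat.card G : ℝ) ≤ B * Nat.card (toPermHom G Ω).ker := by
  let f : G →* Equiv.Perm (Fin (Fintype.card Ω)) :=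
    (Fintype.equivFin Ω).permCongrHom.toMonoidHom.comp (toPermHom G Ω)
  have hker : f.ker = (toPermHom G Ω).ker :=
    MonoidHom.ker_mulEquiv_comp (toPermHom G Ω) (Fintype.equivFin Ω).permCongrHom
  have h := hB f.range (hG.of_surjective f.rangeRestrict f.rangeRestrict_surjective)
  rw [← Subgroup.card_mul_index f.ker, Subgroup.index_ker, hker]
  push_cast
  rw [mul_comm]
  gcongr

theorem DegreeBound.card_le [Fintype Ω] [FaithfulSMul G Ω] {B : ℝ}
    (hB : DegreeBound d (Fintype.card Ω) B) (hG : InGamma d G) :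
    (Nat.card G : ℝ) ≤ B := by
  have h := hB.card_le_mul_card_ker hG (Ω := Ω)
  rw [(MonoidHom.ker_eq_bot_iff _).2 toPerm_injective] at h
  simpa using h

/-- The order of the pointwise stabilizer of a finite set. -/
noncomputable def fixCard (G : Type*) {Ω : Type*} [Group G] [MulAction G Ω] (F : Finset Ω) : ℕ :=
  Nat.card (fixingSubgroup G (F : Set Ω))

theorem fixCard_empty : fixCard G (∅ : Finset Ω) = Nat.card G := by
  simp [fixCard]

theorem fixCard_univ [Fintype Ω] [FaithfulSMul G Ω] : fixCard G (Finset.univ : Finset Ω) = 1 := by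
  rw [fixCard, Nat.card_eq_one_iff_unique]
  refine ⟨⟨fun a b ↦ Subtype.ext (eq_of_smul_eq_smul (α := Ω) fun x ↦ ?_)⟩, ⟨1⟩⟩
  rw [(mem_fixingSubgroup_iff G).1 a.2 x (by simp), (mem_fixingSubgroup_iff G).1 b.2 x (by simp)]

theorem fixCard_le_mul_fixCard_union [Finite G] [DecidableEq Ω] {B : ℝ} (hG : InGamma d G)
    (F U : Finset Ω)
    (hU : ∀ g ∈ fixingSubgroup G (F : Set Ω), ∀ x ∈ U, g • x ∈ U)
    (hB : DegreeBound d U.card B) :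
    (fixCard G F : ℝ) ≤ B * fixCard G (F ∪ U) := by
  let K := fixingSubgroup G (F : Set Ω)
  let S : SubMulAction K Ω :=
    { carrier := U
      smul_mem' := fun g x hx ↦ hU g g.2 x hx }
  have hfin : Fintype S := inferInstanceAs (Fintype U)
  have hcard : Fintype.card S = U.card := by
    rw [← Fintype.card_coe U]; exact Fintype.card_congr (Equiv.refl _)
  have h := DegreeBound.card_le_mul_card_ker (Ω := S) (hcard ▸ hB) (hG.subgroup K)
  have hK : Nat.card (toPermHom K S).ker = fixCard G (F ∪ U) := by
    refine Nat.card_congr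
      { toFun := fun k ↦ ⟨k.1.1, ?_⟩
        invFun := fun k ↦ ⟨⟨k.1, ?_⟩, ?_⟩
        left_inv := fun _ ↦ rfl
        right_inv := fun _ ↦ rfl }
    · rw [mem_fixingSubgroup_iff]
      intro y hy
      rw [Finset.mem_coe, Finset.mem_union] at hy
      rcases hy with hy | hy
      · exact (mem_fixingSubgroup_iff G).1 k.1.2 y hy
      · have := DFunLike.congr_fun (MonoidHom.mem_ker.1 k.2) (⟨y, hy⟩ : S)
        exact congrArg Subtype.val this
    · exact (mem_fixingSubgroup_iff G).2 fun y hy ↦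
        (mem_fixingSubgroup_iff G).1 k.2 y (by simpa using Or.inl hy)
    · rw [MonoidHom.mem_ker]
      ext y
      exact (mem_fixingSubgroup_iff G).1 k.2 y.1
        (Finset.mem_coe.2 (Finset.mem_union_right F y.2))
  rw [hK] at h
  exact h

theorem fixCard_le_card_mul_fixCard_insert [Finite G] [Fintype Ω] [DecidableEq Ω]
    (F : Finset Ω) (x : Ω) :
    fixCard G F ≤ Fintype.card Ω * fixCard G (insert x F) := by
  let K := fixingSubgroup G (F : Set Ω)
  have hcard := Subgroup.card_mul_index (stabilizer K x)
  have h1 : (stabilizer K x).index ≤ Fintype.card Ω := by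
    rw [index_stabilizer, ← Nat.card_eq_fintype_card]
    exact Set.ncard_le_card _
  have h2 : Nat.card (stabilizer K x) = fixCard G (insert x F) := by
    refine Nat.card_congr
      { toFun := fun k ↦ ⟨k.1.1, ?_⟩
        invFun := fun k ↦ ⟨⟨k.1, ?_⟩, ?_⟩
        left_inv := fun _ ↦ rfl
        right_inv := fun _ ↦ rfl }
    · rw [mem_fixingSubgroup_iff]
      intro y hy
      rw [Finset.mem_coe, Finset.mem_insert] at hy
      rcases hy with rfl | hy
      · exact k.2
      · exact (mem_fixingSubgroup_iff G).1 k.1.2 y hy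
    · exact (mem_fixingSubgroup_iff G).2 fun y hy ↦
        (mem_fixingSubgroup_iff G).1 k.2 y (by simpa using Or.inr hy)
    · exact (mem_fixingSubgroup_iff G).1 k.2 x (by simp)
  change Nat.card K ≤ _
  rw [← hcard, h2, mul_comm]
  gcongr

theorem fixCard_le_pow_mul_fixCard_union [Finite G] [Fintype Ω] [DecidableEq Ω] (F P : Finset Ω) :
    fixCard G F ≤ Fintype.card Ω ^ P.card * fixCard G (P ∪ F) := by
  induction P using Finset.induction_on with
  | empty => simp
  | insert x P hx ih =>
    rw [Finset.card_insert_of_notMem hx, pow_succ, Finset.insert_union, mul_assoc]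
    exact ih.trans (Nat.mul_le_mul_left _ (fixCard_le_card_mul_fixCard_insert _ _))

theorem card_le_pow_of_base [Finite G] [Fintype Ω] (P : Finset Ω) {k : ℕ} (hk : P.card ≤ k)
    (hn : 0 < Fintype.card Ω) (hP : ∀ g : G, (∀ x ∈ P, g • x = x) → g = 1) :
    Nat.card G ≤ Fintype.card Ω ^ k := by
  classical
  have h := fixCard_le_pow_mul_fixCard_union (G := G) ∅ P
  have h1 : fixCard G (P ∪ ∅) = 1 := by
    rw [fixCard, Nat.card_eq_one_iff_unique]
    refine ⟨⟨fun a b ↦ Subtype.ext ?_⟩, ⟨1⟩⟩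
    have key : ∀ c : fixingSubgroup G ((P ∪ ∅ : Finset Ω) : Set Ω), c.1 = 1 := fun c ↦
      hP c.1 fun x hx ↦ (mem_fixingSubgroup_iff G).1 c.2 x (by simpa using hx)
    rw [key a, key b]
  rw [fixCard_empty, h1, mul_one] at h
  exact h.trans (Nat.pow_le_pow_right hn hk)

/-- `F` contains every set of at most `q` points that its pointwise stabilizer preserves. -/
def IsSmallClosed (G : Type*) {Ω : Type*} [Group G] [MulAction G Ω] (q : ℕ) (F : Finset Ω) :
    Prop :=
  ∀ X : Finset Ω, X.card ≤ q →
    (∀ g ∈ fixingSubgroup G (F : Set Ω), ∀ x ∈ X, g • x ∈ X) → X ⊆ F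

theorem exists_isSmallClosed [Finite G] [Fintype Ω] {q : ℕ} {b : ℝ} (hb : 0 < b) (hG : InGamma d G)
    (hB : ∀ m, 0 < m → m ≤ q → DegreeBound d m (b ^ m)) (F : Finset Ω) :
    ∃ F', F ⊆ F' ∧ IsSmallClosed G q F' ∧
      (fixCard G F : ℝ) * b ^ F.card ≤ b ^ F'.card * fixCard G F' := by
  classical
  induction hk : Fintype.card Ω - F.card using Nat.strong_induction_on generalizing F with
  | _ k ih =>
  by_cases hF : IsSmallClosed G q F
  · exact ⟨F, subset_rfl, hF, by rw [mul_comm]⟩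
  simp only [IsSmallClosed, not_forall] at hF
  obtain ⟨X, hXq, hX, hXF⟩ := hF
  set U := X \ F with hUdef
  have hdisj : Disjoint F U := Finset.disjoint_sdiff
  have hU0 : 0 < U.card := Finset.card_pos.2 (Finset.sdiff_nonempty.2 hXF)
  have hcard : (F ∪ U).card = F.card + U.card := Finset.card_union_of_disjoint hdisj
  have hle : (F ∪ U).card ≤ Fintype.card Ω := Finset.card_le_univ _
  obtain ⟨F', hF', hcl, hbd⟩ := ih (Fintype.card Ω - (F ∪ U).card) (by omega) (F ∪ U) rfl
  refine ⟨F', Finset.subset_union_left.trans hF', hcl, le_trans ?_ hbd⟩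
  have hU : ∀ g ∈ fixingSubgroup G (F : Set Ω), ∀ x ∈ U, g • x ∈ U := by
    intro g hg x hx
    rw [hUdef, Finset.mem_sdiff] at hx ⊢
    refine ⟨hX g hg x hx.1, fun h ↦ hx.2 ?_⟩
    have := (mem_fixingSubgroup_iff G).1 (inv_mem hg) _ h
    rw [inv_smul_smul] at this
    rwa [this]
  have h := fixCard_le_mul_fixCard_union hG F U hU
    (hB _ hU0 ((Finset.card_le_card Finset.sdiff_subset).trans hXq))
  calc (fixCard G F : ℝ) * b ^ F.card
      ≤ (b ^ U.card * fixCard G (F ∪ U)) * b ^ F.card := by gcongr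
    _ = fixCard G (F ∪ U) * b ^ (F ∪ U).card := by rw [hcard, pow_add]; ring

end Actions

open Classical in
theorem exists_hitting_finset {A S : Type*} [Fintype A] [Fintype S] [Nonempty S]
    (hit : S → A → Prop)
    {ε : ℝ} (hε1 : ε ≤ 1)
    (hhit : ∀ a, ε * Fintype.card S ≤ ((Finset.univ.filter fun s ↦ hit s a).card : ℝ))
    (k : ℕ) (hk : (1 - ε) ^ k * Fintype.card A < 1) :
    ∃ P : Finset S, P.card ≤ k ∧ ∀ a, ∃ s ∈ P, hit s a := by
  classical
  have key : ∀ j : ℕ, ∃ P : Finset S, P.card ≤ j ∧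
      ((Finset.univ.filter fun a ↦ ∀ s ∈ P, ¬ hit s a).card : ℝ) ≤
        (1 - ε) ^ j * Fintype.card A := by
    intro j
    induction j with
    | zero => exact ⟨∅, by simp⟩
    | succ j ih =>
      obtain ⟨P, hPj, hP⟩ := ih
      set U := Finset.univ.filter fun a ↦ ∀ s ∈ P, ¬ hit s a with hU
      rcases U.eq_empty_or_nonempty with hUe | ⟨a0, ha0⟩
      · refine ⟨P, hPj.trans (Nat.le_succ j), ?_⟩
        rw [← hU, hUe]
        have : 0 ≤ 1 - ε := by linarith
        simpa using by positivity
      -- some point hits at least the average proportion of the unhit elements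
      have hsum : ∑ s : S, ((U.filter fun a ↦ hit s a).card : ℝ) ≥
          U.card * (ε * Fintype.card S) := by
        have h := Finset.sum_card_bipartiteAbove_eq_sum_card_bipartiteBelow
          (s := (Finset.univ : Finset S)) (t := U) hit
        simp only [Finset.bipartiteAbove, Finset.bipartiteBelow] at h
        have h' : ∑ s : S, ((U.filter fun a ↦ hit s a).card : ℝ) =
            ∑ a ∈ U, ((Finset.univ.filter fun s ↦ hit s a).card : ℝ) := by exact_mod_cast h
        rw [h', ← nsmul_eq_mul]
        exact Finset.card_nsmul_le_sum _ _ _ fun a _ ↦ hhit a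
      obtain ⟨s, hs⟩ : ∃ s : S, ε * U.card ≤ ((U.filter fun a ↦ hit s a).card : ℝ) := by
        by_contra! hcon
        have := Finset.sum_lt_sum_of_nonempty (Finset.univ_nonempty (α := S))
          fun s _ ↦ hcon s
        simp only [Finset.sum_const, Finset.card_univ, nsmul_eq_mul] at this
        nlinarith
      refine ⟨insert s P, (Finset.card_insert_le _ _).trans (by omega), ?_⟩
      have hsplit : (Finset.univ.filter fun a ↦ ∀ t ∈ insert s P, ¬ hit t a) =
          U.filter fun a ↦ ¬ hit s a := by
        ext a
        simp [hU, and_comm]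
      have hadd : ((U.filter fun a ↦ hit s a).card : ℝ) + (U.filter fun a ↦ ¬ hit s a).card =
          U.card := by
        exact_mod_cast Finset.card_filter_add_card_filter_not _
      rw [hsplit, pow_succ]
      have h1 : 0 ≤ 1 - ε := by linarith
      nlinarith
  obtain ⟨P, hPk, hP⟩ := key k
  refine ⟨P, hPk, fun a ↦ ?_⟩
  by_contra! hcon
  have : 0 < (Finset.univ.filter fun a ↦ ∀ s ∈ P, ¬ hit s a).card :=
    Finset.card_pos.2 ⟨a, by simpa using hcon⟩
  have : (1 : ℝ) ≤ (Finset.univ.filter fun a ↦ ∀ s ∈ P, ¬ hit s a).card := by exact_mod_cast this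
  linarith

section Counting

variable {K V : Type*} [Group K] [MulAction K V]

/-- For an invariant relation on a finite set permuted transitively, all in- and out-degrees
agree. -/
theorem card_filter_eq_card_filter_swap [DecidableEq V] {W : Finset V}
    (hW : ∀ p ∈ W, ∀ w ∈ W, ∃ g : K, g • p = w) (hinv : ∀ g : K, ∀ p ∈ W, g • p ∈ W)
    {T : V → V → Prop} [DecidableRel T] (hT : ∀ (g : K) p w, T p w → T (g • p) (g • w))
    {p w : V} (hp : p ∈ W) (hw : w ∈ W) :
    (W.filter fun v ↦ T p v).card = (W.filter fun v ↦ T v w).card := by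
  have h1 : ∀ v ∈ W, (W.filter fun u ↦ T v u).card = (W.filter fun u ↦ T p u).card := by
    have : ∀ v ∈ W, ∀ v' ∈ W,
        (W.filter fun u ↦ T v u).card ≤ (W.filter fun u ↦ T v' u).card := by
      intro v hv v' hv'
      obtain ⟨g, rfl⟩ := hW v hv v' hv'
      refine Finset.card_le_card_of_injOn (g • ·) ?_ (MulAction.injective g).injOn
      intro u hu
      simp only [Finset.coe_filter, Set.mem_ofPred_eq] at hu ⊢
      exact ⟨hinv g u hu.1, hT g _ _ hu.2⟩
    exact fun v hv ↦ le_antisymm (this v hv p hp) (this p hp v hv)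
  have h2 : ∀ v ∈ W, (W.filter fun u ↦ T u v).card = (W.filter fun u ↦ T u w).card := by
    have : ∀ v ∈ W, ∀ v' ∈ W,
        (W.filter fun u ↦ T u v).card ≤ (W.filter fun u ↦ T u v').card := by
      intro v hv v' hv'
      obtain ⟨g, rfl⟩ := hW v hv v' hv'
      refine Finset.card_le_card_of_injOn (g • ·) ?_ (MulAction.injective g).injOn
      intro u hu
      simp only [Finset.coe_filter, Set.mem_ofPred_eq] at hu ⊢
      exact ⟨hinv g u hu.1, hT g _ _ hu.2⟩
    exact fun v hv ↦ le_antisymm (this v hv w hw) (this w hw v hv)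
  have h := Finset.sum_card_bipartiteAbove_eq_sum_card_bipartiteBelow (s := W) (t := W) T
  simp only [Finset.bipartiteAbove, Finset.bipartiteBelow] at h
  rw [Finset.sum_congr rfl h1, Finset.sum_congr rfl h2, Finset.sum_const, Finset.sum_const,
    smul_eq_mul, smul_eq_mul] at h
  exact Nat.eq_of_mul_eq_mul_left (Finset.card_pos.2 ⟨p, hp⟩) h

end Counting

/-- The orbital graphs of a finite primitive group are connected. -/
theorem eq_univ_of_isPreprimitive {G Ω : Type*} [Group G] [MulAction G Ω] [Finite Ω]
    [IsPreprimitive G Ω] {E : Ω → Ω → Prop} (hE : ∀ (g : G) x y, E x y → E (g • x) (g • y))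
    {x₀ y₀ : Ω} (h₀ : E x₀ y₀) (hne : x₀ ≠ y₀) {F : Set Ω} (hF : F.Nonempty)
    (hcl : ∀ x ∈ F, ∀ y, E x y → y ∈ F) : F = Set.univ := by
  let R : Ω → Set Ω := fun x ↦ {y | Relation.ReflTransGen E x y}
  have hsub : ∀ (g : G) x, g • R x ⊆ R (g • x) := by
    rintro g x _ ⟨y, hy, rfl⟩
    exact Relation.ReflTransGen.lift (g • ·) (hE g) _ _ hy
  have hR : ∀ (g : G) x, g • R x = R (g • x) := by
    intro g x
    refine (hsub g x).antisymm ?_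
    have := hsub g⁻¹ (g • x)
    rw [inv_smul_smul] at this
    rwa [Set.subset_smul_set_iff]
  have hcard : ∀ x y, (R x).ncard = (R y).ncard := by
    intro x y
    obtain ⟨g, rfl⟩ := exists_smul_eq G x y
    rw [← hR, Set.ncard_smul_set]
  have heq : ∀ x, ∀ y ∈ R x, R y = R x := by
    intro x y hy
    refine Set.eq_of_subset_of_ncard_le (fun z hz ↦ Relation.ReflTransGen.trans hy hz)
      (hcard x y).le (Set.toFinite _)
  have hblock : IsBlock G (R x₀) := by
    rw [isBlock_iff_smul_eq_or_disjoint]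
    intro g
    rw [or_iff_not_imp_right, Set.not_disjoint_iff]
    rintro ⟨z, hz1, hz2⟩
    rw [hR] at hz1 ⊢
    rw [← heq _ z hz1, heq _ z hz2]
  have hall : ∀ x, R x = Set.univ := by
    rcases IsPreprimitive.isTrivialBlock_of_isBlock hblock with h | h
    · exact absurd (h (show x₀ ∈ R x₀ from Relation.ReflTransGen.refl)
        (show y₀ ∈ R x₀ from Relation.ReflTransGen.single h₀)) hne
    · intro x
      obtain ⟨g, rfl⟩ := exists_smul_eq G x₀ x
      rw [← hR, h, Set.smul_set_univ]
  obtain ⟨x, hx⟩ := hF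
  refine Set.eq_univ_of_forall fun y ↦ ?_
  have hy : y ∈ R x := by rw [hall x]; exact Set.mem_univ y
  change Relation.ReflTransGen E x y at hy
  induction hy with
  | refl => exact hx
  | tail _ h ih => exact hcl _ ih _ h

/-- In a primitive group, the balls of an invariant pseudometric around a point grow at least
linearly, at a rate given by the smallest invariant set of the point stabilizer. -/
theorem mul_dist_le_of_isPreprimitive {G Ω : Type*} [Group G] [MulAction G Ω] [Fintype Ω]
    [IsPreprimitive G Ω] {D : Ω → Ω → ℕ} (hD : ∀ (g : G) x y, D (g • x) (g • y) = D x y)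
    (hself : ∀ x, D x x = 0) (htri : ∀ x y z, D x z ≤ D x y + D y z) {q s : ℕ} (hq : 0 < q)
    (hmin : ∀ (x : Ω) (T : Finset Ω), T.Nonempty → x ∉ T →
      (∀ g : G, g • x = x → ∀ y ∈ T, g • y ∈ T) → q ≤ T.card)
    {x₁ y₁ : Ω} (hs : D x₁ y₁ ≤ s) (hne : x₁ ≠ y₁) (x y : Ω) :
    q * D x y ≤ 2 * Fintype.card Ω * s := by
  classical
  set n := Fintype.card Ω with hn
  have key : ∀ j : ℕ, (∀ y, D x y ≤ j * s) ∨
      j * q < (Finset.univ.filter fun y ↦ D x y ≤ j * s).card := by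
    intro j
    induction j with
    | zero =>
      right
      simp only [zero_mul]
      exact Finset.card_pos.2 ⟨x, by simp [hself]⟩
    | succ j ih =>
      rcases ih with h | h
      · exact Or.inl fun y ↦ (h y).trans (Nat.mul_le_mul_right _ (Nat.le_succ j))
      set B := Finset.univ.filter fun y ↦ D x y ≤ j * s with hB
      set B' := Finset.univ.filter fun y ↦ D x y ≤ (j + 1) * s with hB'
      have hBB' : B ⊆ B' := by
        intro y hy
        simp only [hB, hB', Finset.mem_filter, Finset.mem_univ, true_and] at hy ⊢
        exact hy.trans (Nat.mul_le_mul_right _ (Nat.le_succ j))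
      have hx : x ∈ B := by simp [hB, hself]
      rcases (B' \ B).eq_empty_or_nonempty with he | hne'
      · left
        have hu : (B : Set Ω) = Set.univ := by
          refine eq_univ_of_isPreprimitive (G := G) (E := fun a b ↦ D a b ≤ s)
            (fun g a b h ↦ by rwa [hD]) hs hne ⟨x, hx⟩ fun a ha b hab ↦ ?_
          have : b ∈ B' := by
            simp only [hB, hB', Finset.coe_filter, Set.mem_ofPred_eq, Finset.mem_filter,
              Finset.mem_univ, true_and] at ha ⊢
            have := htri x a b
            rw [add_mul, one_mul]
            omega
          exact (Finset.sdiff_eq_empty_iff_subset.1 he) this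
        intro y
        have : y ∈ (B : Set Ω) := hu ▸ Set.mem_univ y
        have := hBB' this
        simpa [hB'] using this
      · right
        have h1 : q ≤ (B' \ B).card := by
          refine hmin x _ hne' (by simp [hx]) fun g hg y hy ↦ ?_
          have := hD g x y
          rw [hg] at this
          simpa [hB, hB', this] using hy
        have h2 := Finset.card_sdiff_add_card_eq_card hBB'
        rw [add_mul, one_mul]
        omega
  have hfin : D x y ≤ (n / q + 1) * s := by
    rcases key (n / q + 1) with h | h
    · exact h y
    · exfalso
      have h1 := Finset.card_le_univ (Finset.univ.filter fun y ↦ D x y ≤ (n / q + 1) * s)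
      have h2 := Nat.lt_div_mul_add (a := n) hq
      rw [add_mul, one_mul] at h
      omega
  have hqn : q ≤ n := by
    have : ({y₁} : Finset Ω).card ≤ n := Finset.card_le_univ _
    have h := hmin x₁ (Finset.univ.erase x₁) ⟨y₁, by simp [hne.symm]⟩ (by simp) fun g hg y hy ↦ by
      simp only [Finset.mem_erase, Finset.mem_univ, and_true] at hy ⊢
      intro h
      apply hy
      rw [← hg] at h
      exact smul_left_cancel _ h
    exact h.trans (Finset.card_le_univ _)
  calc q * D x y ≤ q * ((n / q + 1) * s) := Nat.mul_le_mul_left _ hfin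
    _ = (n / q * q + q) * s := by ring
    _ ≤ 2 * n * s := Nat.mul_le_mul_right _ (by have := Nat.div_mul_le_self n q; omega)

section Uniprimitive

variable {d : ℕ} {G Ω : Type*} [Group G] [MulAction G Ω] [Fintype Ω]

open Classical in
/-- An orbital relation of smallest valency of a primitive group that is not 2-transitive. -/
theorem exists_minimal_orbital [IsPreprimitive G Ω] {a₀ b₀ c₀ : Ω} (hab : a₀ ≠ b₀) (hac : a₀ ≠ c₀)
    (hbc : ∀ g : G, g • a₀ = a₀ → g • b₀ ≠ c₀) :
    ∃ (q : ℕ) (E : Ω → Ω → Prop), 0 < q ∧ 2 * q ≤ Fintype.card Ω ∧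
      (∀ (g : G) x y, E x y → E (g • x) (g • y)) ∧ (∃ x y, x ≠ y ∧ E x y) ∧
      (∀ x, (Finset.univ.filter fun y ↦ E x y).card = q) ∧
      (∀ (x : Ω) (T : Finset Ω), T.Nonempty → x ∉ T →
        (∀ g : G, g • x = x → ∀ y ∈ T, g • y ∈ T) → q ≤ T.card) := by
  let S : Ω → Ω → Finset Ω := fun x y ↦ Finset.univ.filter fun z ↦ ∃ g : G, g • x = x ∧ g • y = z
  have hSmem : ∀ x y z, z ∈ S x y ↔ ∃ g : G, g • x = x ∧ g • y = z := by simp [S]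
  obtain ⟨⟨x₀, y₀⟩, h₀, hmin⟩ := Finset.exists_min_image
    ((Finset.univ : Finset (Ω × Ω)).filter fun p ↦ p.1 ≠ p.2) (fun p ↦ (S p.1 p.2).card)
    ⟨(a₀, b₀), by simpa using hab⟩
  simp only [Finset.mem_filter, Finset.mem_univ, true_and, Prod.forall] at h₀ hmin
  have hmin' : ∀ (x : Ω) (T : Finset Ω), T.Nonempty → x ∉ T →
      (∀ g : G, g • x = x → ∀ y ∈ T, g • y ∈ T) → (S x₀ y₀).card ≤ T.card := by
    rintro x T ⟨y, hy⟩ hx hT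
    refine (hmin x y (by rintro rfl; exact hx hy)).trans (Finset.card_le_card fun z hz ↦ ?_)
    obtain ⟨g, hg, rfl⟩ := (hSmem _ _ _).1 hz
    exact hT g hg y hy
  have hSinv : ∀ x y, ∀ g : G, g • x = x → ∀ z ∈ S x y, g • z ∈ S x y := by
    intro x y g hg z hz
    obtain ⟨k, hk, rfl⟩ := (hSmem _ _ _).1 hz
    exact (hSmem _ _ _).2 ⟨g * k, by rw [mul_smul, hk, hg], mul_smul _ _ _⟩
  have hSself : ∀ x y, y ∈ S x y := fun x y ↦ (hSmem _ _ _).2 ⟨1, by simp⟩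
  have hxS : ∀ x y, x ≠ y → x ∉ S x y := by
    intro x y hne hx
    obtain ⟨g, hg, hgy⟩ := (hSmem _ _ _).1 hx
    rw [← hg] at hgy
    exact hne (by rw [← hg]; exact ((smul_left_cancel _ hgy).trans rfl).symm ▸ (by rw [hg]))
  let E : Ω → Ω → Prop := fun x y ↦ ∃ g : G, g • x₀ = x ∧ g • y₀ = y
  have hE : ∀ (g : G) x y, E x y → E (g • x) (g • y) := by
    rintro g _ _ ⟨k, rfl, rfl⟩
    exact ⟨g * k, mul_smul _ _ _, mul_smul _ _ _⟩
  have hle : ∀ (g : G) x, (Finset.univ.filter fun y ↦ E x y).card ≤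
      (Finset.univ.filter fun y ↦ E (g • x) y).card := by
    intro g x
    refine Finset.card_le_card_of_injOn (g • ·) ?_ (MulAction.injective g).injOn
    intro u hu
    simp only [Finset.coe_filter, Finset.mem_univ, true_and, Set.mem_ofPred_eq] at hu ⊢
    exact hE g _ _ hu
  refine ⟨(S x₀ y₀).card, E, Finset.card_pos.2 ⟨_, hSself _ _⟩, ?_, hE,
    ⟨x₀, y₀, h₀, 1, by simp⟩, ?_, hmin'⟩
  · have hdisj : Disjoint (S a₀ b₀) (S a₀ c₀) := by
      rw [Finset.disjoint_left]
      intro z hz hz'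
      obtain ⟨g, hg, hgz⟩ := (hSmem _ _ _).1 hz
      obtain ⟨k, hk, hkz⟩ := (hSmem _ _ _).1 hz'
      refine hbc (k⁻¹ * g) ?_ ?_
      · rw [mul_smul, hg, inv_smul_eq_iff, hk]
      · rw [mul_smul, hgz, inv_smul_eq_iff, hkz]
    have h1 := hmin' a₀ (S a₀ b₀) ⟨_, hSself _ _⟩ (hxS _ _ hab) (hSinv _ _)
    have h2 := hmin' a₀ (S a₀ c₀) ⟨_, hSself _ _⟩ (hxS _ _ hac) (hSinv _ _)
    have h3 := Finset.card_le_univ (S a₀ b₀ ∪ S a₀ c₀)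
    rw [Finset.card_union_of_disjoint hdisj] at h3
    omega
  · intro x
    obtain ⟨g, rfl⟩ := exists_smul_eq G x₀ x
    have h1 := hle g x₀
    have h2 := hle g⁻¹ (g • x₀)
    rw [inv_smul_smul] at h2
    exact (le_antisymm h1 h2).symm

open Classical in
/-- A primitive group that is not 2-transitive is small: either through a small suborbit, or
through a small base. -/
theorem exists_bounds_of_not_two_transitive [Finite G] [FaithfulSMul G Ω] [IsPreprimitive G Ω]
    (hG : InGamma d G) (h2 : ¬ IsMultiplyPretransitive G Ω 2) (hΩ : 0 < Fintype.card Ω) :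
    ∃ q : ℕ, 0 < q ∧ 2 * q ≤ Fintype.card Ω ∧
      (∀ b : ℝ, 1 ≤ b → (∀ m, 0 < m → m ≤ q → DegreeBound d m (b ^ m)) →
        (Nat.card G : ℝ) ≤ Fintype.card Ω * b ^ Fintype.card Ω) ∧
      (∀ k : ℕ, (1 - (q : ℝ) ^ 2 / (2 * (Fintype.card Ω : ℝ) ^ 2)) ^ k *
        (Fintype.card Ω : ℝ) ^ 2 < 1 → Nat.card G ≤ Fintype.card Ω ^ k) := by
  obtain ⟨a₀, b₀, c₀, hab, hac, hbc⟩ : ∃ a₀ b₀ c₀ : Ω, a₀ ≠ b₀ ∧ a₀ ≠ c₀ ∧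
      ∀ g : G, g • a₀ = a₀ → g • b₀ ≠ c₀ := by
    by_contra! hcon
    refine h2 (is_two_pretransitive_iff.2 fun {a b c e} hab hce ↦ ?_)
    obtain ⟨g, rfl⟩ := exists_smul_eq G a c
    obtain ⟨k, hk, hk'⟩ := hcon (g • a) (g • b) e (by simpa using hab) hce
    exact ⟨k * g, by rw [mul_smul, hk], by rw [mul_smul, hk']⟩
  obtain ⟨q, E, hq, hqn, hE, ⟨x₀, y₀, hne, h₀⟩, hout, hmin⟩ :=
    exists_minimal_orbital (G := G) hab hac hbc
  set n := Fintype.card Ω with hn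
  have hin : ∀ y, (Finset.univ.filter fun x ↦ E x y).card = q := fun y ↦
    (card_filter_eq_card_filter_swap (K := G) (W := Finset.univ) (T := E)
      (fun p _ w _ ↦ exists_smul_eq G p w) (fun _ _ _ ↦ Finset.mem_univ _) hE
      (Finset.mem_univ x₀) (Finset.mem_univ y)).symm.trans (hout x₀)
  refine ⟨q, hq, hqn, ?_, ?_⟩
  · intro b hb hB
    obtain ⟨F, hF0, hF, hle⟩ := exists_isSmallClosed (zero_lt_one.trans_le hb) hG hB {x₀}
    have hFu : F = Finset.univ := by
      rw [← Finset.coe_eq_univ]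
      refine eq_univ_of_isPreprimitive (G := G) hE h₀ hne ⟨x₀, hF0 (by simp)⟩ fun x hx y hxy ↦ ?_
      refine hF (Finset.univ.filter fun y ↦ E x y) (hout x).le (fun g hg z hz ↦ ?_)
        (by simpa using hxy)
      have := hE g x z (by simpa using hz)
      rw [(mem_fixingSubgroup_iff G).1 hg x hx] at this
      simpa using this
    have h1 := fixCard_le_card_mul_fixCard_insert (G := G) ∅ x₀
    rw [fixCard_empty] at h1
    rw [hFu, fixCard_univ, Finset.card_univ, Finset.card_singleton, pow_one, Nat.cast_one,
      mul_one] at hle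
    have h2 : (fixCard G {x₀} : ℝ) ≤ b ^ n :=
      (le_mul_of_one_le_right (Nat.cast_nonneg _) hb).trans hle
    calc (Nat.card G : ℝ) ≤ n * fixCard G {x₀} := by exact_mod_cast h1
      _ ≤ _ := by gcongr
  · intro k hk
    let D : Ω → Ω → ℕ := fun x y ↦ (Finset.univ.filter fun z ↦ ¬ (E z x ↔ E z y)).card
    have hEiff : ∀ (g : G) x y, E (g • x) (g • y) ↔ E x y := fun g x y ↦
      ⟨fun h ↦ by simpa using hE g⁻¹ _ _ h, hE g x y⟩
    have hD : ∀ (g : G) x y, D (g • x) (g • y) = D x y := by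
      intro g x y
      refine (Finset.card_bij (fun z _ ↦ g • z) ?_ ?_ ?_).symm
      · intro z hz
        simpa [hEiff] using hz
      · intro z _ w _ h
        exact smul_left_cancel _ h
      · intro z hz
        refine ⟨g⁻¹ • z, ?_, by simp⟩
        simp only [Finset.mem_filter, Finset.mem_univ, true_and] at hz ⊢
        rwa [← hEiff g, ← hEiff g (g⁻¹ • z), smul_inv_smul]
    have hself : ∀ x, D x x = 0 := fun x ↦ by simp [D]
    have htri : ∀ x y z, D x z ≤ D x y + D y z := by
      intro x y z
      refine (Finset.card_le_card ?_).trans (Finset.card_union_le _ _)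
      intro w hw
      simp only [Finset.mem_filter, Finset.mem_univ, true_and, Finset.mem_union] at hw ⊢
      tauto
    -- some pair is separated by at least `q` points
    have hmax : ∃ y, q ≤ D x₀ y := by
      by_contra! hcon
      have h := Finset.sum_card_bipartiteAbove_eq_sum_card_bipartiteBelow
        (s := (Finset.univ : Finset Ω)) (t := (Finset.univ : Finset Ω))
        (fun y z ↦ ¬ (E z x₀ ↔ E z y))
      simp only [Finset.bipartiteAbove, Finset.bipartiteBelow] at h
      have hlt : ∑ y, D x₀ y < ∑ _y : Ω, q :=
        Finset.sum_lt_sum_of_nonempty ⟨x₀, Finset.mem_univ _⟩ fun y _ ↦ hcon y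
      have hge : ∑ _y : Ω, q ≤
          ∑ z, (Finset.univ.filter fun y ↦ ¬ (E z x₀ ↔ E z y)).card := by
        refine Finset.sum_le_sum fun z _ ↦ ?_
        have h3 := Finset.card_filter_add_card_filter_not (s := Finset.univ) (fun y ↦ E z y)
        rw [hout z, Finset.card_univ, ← hn] at h3
        by_cases hz : E z x₀
        · simp only [hz, true_iff]
          omega
        · simp only [hz, false_iff, not_not, hout z, le_refl]
      have : ∑ y, D x₀ y = _ := h
      omega
    obtain ⟨y₂, hy₂⟩ := hmax
    obtain ⟨⟨x₁, y₁⟩, h₁, hmin₁⟩ := Finset.exists_min_image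
      ((Finset.univ : Finset (Ω × Ω)).filter fun p ↦ p.1 ≠ p.2) (fun p ↦ D p.1 p.2)
      ⟨(a₀, b₀), by simpa using hab⟩
    simp only [Finset.mem_filter, Finset.mem_univ, true_and, Prod.forall] at h₁ hmin₁
    have hs := mul_dist_le_of_isPreprimitive hD hself htri hq hmin le_rfl h₁ x₀ y₂
    have hDmin : ∀ x y, x ≠ y → q * q ≤ 2 * n * D x y := fun x y hxy ↦
      (Nat.mul_le_mul_left _ hy₂).trans (hs.trans (Nat.mul_le_mul_left _ (hmin₁ x y hxy)))
    have hn0 : (0 : ℝ) < n := by exact_mod_cast hΩ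
    have : Nonempty Ω := ⟨x₀⟩
    have hε : (q : ℝ) ^ 2 / (2 * (n : ℝ) ^ 2) ≤ 1 := by
      rw [div_le_one (by positivity)]
      have : (q : ℝ) ≤ n := by exact_mod_cast (by omega : q ≤ n)
      have : (q : ℝ) ^ 2 ≤ (n : ℝ) ^ 2 := by gcongr
      nlinarith
    have hhit : ∀ p : {p : Ω × Ω // p.1 ≠ p.2}, (q : ℝ) ^ 2 / (2 * (n : ℝ) ^ 2) * Fintype.card Ω ≤
        ((Finset.univ.filter fun z ↦ ¬ (E z p.1.1 ↔ E z p.1.2)).card : ℝ) := by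
      rintro ⟨⟨x, y⟩, hxy⟩
      have h3 : ((q * q : ℕ) : ℝ) ≤ (2 * n * D x y : ℕ) := by exact_mod_cast hDmin x y hxy
      push_cast at h3
      rw [← hn, div_mul_eq_mul_div, div_le_iff₀ (by positivity)]
      change _ ≤ (D x y : ℝ) * _
      nlinarith
    have hlt : (1 - (q : ℝ) ^ 2 / (2 * (n : ℝ) ^ 2)) ^ k *
        Fintype.card {p : Ω × Ω // p.1 ≠ p.2} < 1 := by
      refine lt_of_le_of_lt ?_ hk
      have h1 := sub_nonneg.2 hε
      gcongr
      have := Fintype.card_subtype_le fun p : Ω × Ω ↦ p.1 ≠ p.2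
      rw [Fintype.card_prod] at this
      rw [sq]
      exact_mod_cast this
    obtain ⟨P, hPk, hP⟩ := exists_hitting_finset (A := {p : Ω × Ω // p.1 ≠ p.2})
      (fun z p ↦ ¬ (E z p.1.1 ↔ E z p.1.2)) hε (fun p ↦ by convert hhit p) k hlt
    refine card_le_pow_of_base P hPk hΩ fun g hg ↦ ?_
    refine eq_of_smul_eq_smul (α := Ω) fun x ↦ ?_
    rw [one_smul]
    by_contra hx
    obtain ⟨z, hz, hzx⟩ := hP ⟨(g • x, x), hx⟩
    apply hzx
    conv_lhs => rw [← hg z hz]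
    exact hEiff g z x

end Uniprimitive

section Triple

variable {d : ℕ} {G Ω : Type*} [Group G] [MulAction G Ω]

theorem exists_of_not_three_transitive (h2 : IsMultiplyPretransitive G Ω 2)
    (h3 : ¬ IsMultiplyPretransitive G Ω 3) :
    ∃ a b c e : Ω, a ≠ b ∧ a ≠ c ∧ b ≠ c ∧ a ≠ e ∧ b ≠ e ∧
      ∀ g : G, g • a = a → g • b = b → g • c ≠ e := by
  by_contra! hcon
  refine h3 ⟨fun x y ↦ ?_⟩
  have hx : ∀ {i j : Fin 3}, i ≠ j → x i ≠ x j := fun h ↦ x.injective.ne h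
  have hy : ∀ {i j : Fin 3}, i ≠ j → y i ≠ y j := fun h ↦ y.injective.ne h
  obtain ⟨g, hg0, hg1⟩ := is_two_pretransitive_iff.1 h2 (hx (show (0 : Fin 3) ≠ 1 by decide))
    (hy (show (0 : Fin 3) ≠ 1 by decide))
  obtain ⟨k, hk0, hk1, hk2⟩ := hcon (y 0) (y 1) (g • x 2) (y 2) (hy (by decide))
    (by rw [← hg0]; simp) (by rw [← hg1]; simp) (hy (by decide)) (hy (by decide))
  refine ⟨k * g, ?_⟩
  ext i
  rw [Function.Embedding.smul_apply, mul_smul]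
  fin_cases i
  · simpa [hg0] using hk0
  · simpa [hg1] using hk1
  · exact hk2

variable [Fintype Ω]

open Classical in
/-- An invariant ternary relation attached to a 2-transitive group that is not 3-transitive. -/
theorem exists_ternary_relation (h2 : IsMultiplyPretransitive G Ω 2)
    (h3 : ¬ IsMultiplyPretransitive G Ω 3) :
    ∃ (q : ℕ) (R : Ω → Ω → Ω → Prop), 0 < q ∧ 2 * q ≤ Fintype.card Ω ∧
      (∀ (g : G) x y z, R x y z → R (g • x) (g • y) (g • z)) ∧
      (∀ x y z, R x y z → x ≠ y ∧ x ≠ z ∧ y ≠ z) ∧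
      (∀ x y, x ≠ y → (Finset.univ.filter fun z ↦ R x y z).card = q) := by
  have key : ∀ a b c : Ω, a ≠ b → a ≠ c → b ≠ c → ∀ q,
      q = (Finset.univ.filter fun z ↦ ∃ g : G, g • a = a ∧ g • b = b ∧ g • c = z).card →
      2 * q ≤ Fintype.card Ω → ∃ (q : ℕ) (R : Ω → Ω → Ω → Prop), 0 < q ∧
        2 * q ≤ Fintype.card Ω ∧
        (∀ (g : G) x y z, R x y z → R (g • x) (g • y) (g • z)) ∧
        (∀ x y z, R x y z → x ≠ y ∧ x ≠ z ∧ y ≠ z) ∧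
        (∀ x y, x ≠ y → (Finset.univ.filter fun z ↦ R x y z).card = q) := by
    intro a b c hab hac hbc q hq hqn
    let R : Ω → Ω → Ω → Prop := fun x y z ↦ ∃ g : G, g • a = x ∧ g • b = y ∧ g • c = z
    have hR : ∀ (g : G) x y z, R x y z → R (g • x) (g • y) (g • z) := by
      rintro g _ _ _ ⟨k, rfl, rfl, rfl⟩
      exact ⟨g * k, mul_smul _ _ _, mul_smul _ _ _, mul_smul _ _ _⟩
    have hle : ∀ (g : G) x y, (Finset.univ.filter fun z ↦ R x y z).card ≤
        (Finset.univ.filter fun z ↦ R (g • x) (g • y) z).card := by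
      intro g x y
      refine Finset.card_le_card_of_injOn (g • ·) ?_ (MulAction.injective g).injOn
      intro u hu
      simp only [Finset.coe_filter, Finset.mem_univ, true_and, Set.mem_ofPred_eq] at hu ⊢
      exact hR g _ _ _ hu
    refine ⟨q, R, ?_, hqn, hR, ?_, ?_⟩
    · rw [hq]
      exact Finset.card_pos.2 ⟨c, by simpa using ⟨1, by simp⟩⟩
    · rintro _ _ _ ⟨g, rfl, rfl, rfl⟩
      simpa using ⟨hab, hac, hbc⟩
    · intro x y hxy
      obtain ⟨g, rfl, rfl⟩ := is_two_pretransitive_iff.1 h2 hab hxy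
      have h1 := hle g a b
      have h2 := hle g⁻¹ (g • a) (g • b)
      rw [inv_smul_smul, inv_smul_smul] at h2
      rw [hq]
      exact (le_antisymm h1 h2).symm
  obtain ⟨a, b, c, e, hab, hac, hbc, hae, hbe, h⟩ := exists_of_not_three_transitive h2 h3
  have hdisj : Disjoint
      (Finset.univ.filter fun z ↦ ∃ g : G, g • a = a ∧ g • b = b ∧ g • c = z)
      (Finset.univ.filter fun z ↦ ∃ g : G, g • a = a ∧ g • b = b ∧ g • e = z) := by
    rw [Finset.disjoint_left]
    simp only [Finset.mem_filter, Finset.mem_univ, true_and]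
    rintro z ⟨g, hga, hgb, hgz⟩ ⟨k, hka, hkb, hkz⟩
    refine h (k⁻¹ * g) ?_ ?_ ?_
    · rw [mul_smul, hga, inv_smul_eq_iff, hka]
    · rw [mul_smul, hgb, inv_smul_eq_iff, hkb]
    · rw [mul_smul, hgz, inv_smul_eq_iff, hkz]
  have hcard := Finset.card_le_univ
    ((Finset.univ.filter fun z ↦ ∃ g : G, g • a = a ∧ g • b = b ∧ g • c = z) ∪
      (Finset.univ.filter fun z ↦ ∃ g : G, g • a = a ∧ g • b = b ∧ g • e = z))
  rw [Finset.card_union_of_disjoint hdisj] at hcard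
  by_cases hq : 2 * (Finset.univ.filter fun z ↦
      ∃ g : G, g • a = a ∧ g • b = b ∧ g • c = z).card ≤ Fintype.card Ω
  · exact key a b c hab hac hbc _ rfl hq
  · exact key a b e hab hae hbe _ rfl (by omega)

open Classical in
/-- If `R` is a ternary relation as above, a closed set together with one further point
generates a closed set at least twice as large. -/
theorem IsSmallClosed.two_mul_card_le {q : ℕ} {R : Ω → Ω → Ω → Prop} (hq : 0 < q)
    (hR : ∀ (g : G) x y z, R x y z → R (g • x) (g • y) (g • z))
    (hne : ∀ x y z, R x y z → x ≠ y ∧ x ≠ z ∧ y ≠ z)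
    (h₁ : ∀ y z, y ≠ z → (Finset.univ.filter fun x ↦ R x y z).card = q)
    (h₂ : ∀ x z, x ≠ z → (Finset.univ.filter fun y ↦ R x y z).card = q)
    (h₃ : ∀ x y, x ≠ y → (Finset.univ.filter fun z ↦ R x y z).card = q)
    {F F' : Finset Ω} (hF : IsSmallClosed G q F) (hF' : IsSmallClosed G q F') {c : Ω}
    (hc : c ∉ F) (hFF' : insert c F ⊆ F') : 2 * F.card ≤ F'.card := by
  set U := Finset.univ.filter fun z ↦ ∃ x ∈ F, R x c z with hU
  have hinter : Disjoint F U := by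
    rw [Finset.disjoint_left]
    intro z hz hzU
    obtain ⟨x, hx, hxz⟩ : ∃ x ∈ F, R x c z := by simpa [hU] using hzU
    refine hc (hF (Finset.univ.filter fun y ↦ R x y z) (h₂ x z (hne _ _ _ hxz).2.1).le
      (fun g hg y hy ↦ ?_) (by simpa using hxz))
    have := hR g x y z (by simpa using hy)
    rw [(mem_fixingSubgroup_iff G).1 hg x hx, (mem_fixingSubgroup_iff G).1 hg z hz] at this
    simpa using this
  have hsub : F ∪ U ⊆ F' := by
    refine Finset.union_subset ((Finset.subset_insert _ _).trans hFF') fun z hz ↦ ?_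
    obtain ⟨x, hx, hxz⟩ : ∃ x ∈ F, R x c z := by simpa [hU] using hz
    refine hF' (Finset.univ.filter fun z ↦ R x c z) (h₃ x c (hne _ _ _ hxz).1).le
      (fun g hg y hy ↦ ?_) (by simpa using hxz)
    have := hR g x c y (by simpa using hy)
    rw [(mem_fixingSubgroup_iff G).1 hg x (hFF' (Finset.mem_insert_of_mem hx)),
      (mem_fixingSubgroup_iff G).1 hg c (hFF' (Finset.mem_insert_self _ _))] at this
    simpa using this
  have hcard : F.card * q ≤ U.card * q := by
    refine Finset.card_mul_le_card_mul (fun x z ↦ R x c z) (fun x hx ↦ ?_) (fun z hz ↦ ?_)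
    · rw [← h₃ x c (by rintro rfl; exact hc hx)]
      refine Finset.card_le_card fun z hz ↦ ?_
      simp only [Finset.mem_filter, Finset.mem_univ, true_and, Finset.mem_bipartiteAbove,
        hU] at hz ⊢
      exact ⟨⟨x, hx, hz⟩, hz⟩
    · obtain ⟨x, hx, hxz⟩ : ∃ x ∈ F, R x c z := by simpa [hU] using hz
      rw [← h₁ c z (hne _ _ _ hxz).2.2]
      refine Finset.card_le_card fun y hy ↦ ?_
      simp only [Finset.mem_filter, Finset.mem_univ, true_and, Finset.mem_bipartiteBelow] at hy ⊢
      exact hy.2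
  have := Nat.le_of_mul_le_mul_right hcard hq
  have := Finset.card_le_card hsub
  rw [Finset.card_union_of_disjoint hinter] at this
  omega

open Classical in
/-- A 2-transitive group that is not 3-transitive is small: either through a small orbit of a
two-point stabilizer, or through a small base. -/
theorem exists_bounds_of_not_three_transitive [Finite G] [FaithfulSMul G Ω]
    (hG : InGamma d G) (h2 : IsMultiplyPretransitive G Ω 2)
    (h3 : ¬ IsMultiplyPretransitive G Ω 3) :
    ∃ q : ℕ, 0 < q ∧ 2 * q ≤ Fintype.card Ω ∧
      (∀ b : ℝ, 1 ≤ b → (∀ m, 0 < m → m ≤ q → DegreeBound d m (b ^ m)) →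
        (Nat.card G : ℝ) ≤
          (Fintype.card Ω : ℝ) ^ (Nat.log 2 (Fintype.card Ω) + 2) * b ^ Fintype.card Ω) ∧
      (∀ k : ℕ, (1 - (q : ℝ) / (2 * Fintype.card Ω)) ^ k * (Fintype.card Ω : ℝ) ^ 2 < 1 →
        Nat.card G ≤ Fintype.card Ω ^ (2 * k)) := by
  obtain ⟨q, R, hq, hqn, hR, hne, h₃⟩ := exists_ternary_relation h2 h3
  set n := Fintype.card Ω with hn
  have hn1 : 1 ≤ n := by omega
  let W : Finset (Ω × Ω) := Finset.univ.filter fun p ↦ p.1 ≠ p.2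
  have hWmem : ∀ x y : Ω, (x, y) ∈ W ↔ x ≠ y := by simp [W]
  have hW : ∀ p ∈ W, ∀ w ∈ W, ∃ g : G, g • p = w := by
    rintro ⟨x, y⟩ hp ⟨z, w⟩ hw
    obtain ⟨g, hg, hg'⟩ := is_two_pretransitive_iff.1 h2 ((hWmem _ _).1 hp) ((hWmem _ _).1 hw)
    exact ⟨g, Prod.ext hg hg'⟩
  have hWinv : ∀ g : G, ∀ p ∈ W, g • p ∈ W := by
    rintro g ⟨x, y⟩ hp
    simpa [W] using hp
  obtain ⟨a, b, hab⟩ : ∃ a b : Ω, a ≠ b := by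
    have : 1 < Fintype.card Ω := by omega
    exact Fintype.one_lt_card_iff.1 this
  have hproj : ∀ (T : Ω × Ω → Prop) (f : Ω → Ω × Ω), Function.Injective f →
      (∀ p, T p → p ∈ W ∧ p ∈ Set.range f) →
      (W.filter T).card = (Finset.univ.filter fun x ↦ T (f x)).card := by
    intro T f hf hT
    symm
    refine Finset.card_bij (fun x _ ↦ f x) ?_ (fun x _ y _ h ↦ hf h) ?_
    · intro x hx
      have hx : T (f x) := by simpa using hx
      exact Finset.mem_filter.2 ⟨(hT _ hx).1, hx⟩
    · intro p hp
      have hp := (Finset.mem_filter.1 hp).2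
      obtain ⟨x, rfl⟩ := (hT p hp).2
      exact ⟨x, by simpa using hp, rfl⟩
  have h₂ : ∀ x z, x ≠ z → (Finset.univ.filter fun y ↦ R x y z).card = q := by
    intro x z hxz
    have h := card_filter_eq_card_filter_swap hW hWinv
      (T := fun p w ↦ p.1 = w.1 ∧ R p.1 p.2 w.2)
      (fun g p w h ↦ ⟨by simp [h.1], hR g _ _ _ h.2⟩) ((hWmem a b).2 hab) ((hWmem x z).2 hxz)
    have e₁ := hproj (fun w ↦ a = w.1 ∧ R a b w.2) (fun y ↦ (a, y)) (Prod.mk_right_injective a)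
      fun p hp ↦ ⟨(hWmem _ _).2 (hp.1 ▸ (hne _ _ _ hp.2).2.1), p.2, Prod.ext hp.1 rfl⟩
    have e₂ := hproj (fun p ↦ p.1 = x ∧ R p.1 p.2 z) (fun y ↦ (x, y)) (Prod.mk_right_injective x)
      fun p hp ↦ ⟨(hWmem _ _).2 (hne _ _ _ hp.2).1, p.2, Prod.ext hp.1.symm rfl⟩
    simp only [true_and] at e₁ e₂
    rw [← e₂, ← h₃ a b hab, ← e₁]
    convert h.symm
  have h₁ : ∀ y z, y ≠ z → (Finset.univ.filter fun x ↦ R x y z).card = q := by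
    intro y z hyz
    have h := card_filter_eq_card_filter_swap hW hWinv
      (T := fun p w ↦ p.2 = w.1 ∧ R p.1 p.2 w.2)
      (fun g p w h ↦ ⟨by simp [← h.1], hR g _ _ _ h.2⟩) ((hWmem a b).2 hab) ((hWmem y z).2 hyz)
    have e₁ := hproj (fun w ↦ b = w.1 ∧ R a b w.2) (fun x ↦ (b, x)) (Prod.mk_right_injective b)
      fun p hp ↦ ⟨(hWmem _ _).2 (hp.1 ▸ (hne _ _ _ hp.2).2.2), p.2, Prod.ext hp.1 rfl⟩
    have e₂ := hproj (fun p ↦ p.2 = y ∧ R p.1 p.2 z) (fun x ↦ (x, y)) (Prod.mk_left_injective y)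
      fun p hp ↦ ⟨(hWmem _ _).2 (hne _ _ _ hp.2).1, p.1, Prod.ext rfl hp.1.symm⟩
    simp only [true_and] at e₁ e₂
    rw [← e₂, ← h₃ a b hab, ← e₁]
    convert h.symm
  refine ⟨q, hq, hqn, ?_, ?_⟩
  · intro β hβ hB
    have hβ0 := zero_lt_one.trans_le hβ
    have key : ∀ j : ℕ, ∃ F : Finset Ω, IsSmallClosed G q F ∧ (F = Finset.univ ∨ 2 ^ j ≤ F.card) ∧
        (Nat.card G : ℝ) ≤ (n : ℝ) ^ (j + 1) * (β ^ F.card * fixCard G F) := by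
      have hext : ∀ F : Finset Ω, ∀ c, ∃ F', insert c F ⊆ F' ∧ IsSmallClosed G q F' ∧
          β ^ F.card * (fixCard G F : ℝ) ≤ n * (β ^ F'.card * fixCard G F') := by
        intro F c
        obtain ⟨F', hsub, hF', hle⟩ := exists_isSmallClosed hβ0 hG hB (insert c F)
        refine ⟨F', hsub, hF', ?_⟩
        have h1 : (fixCard G F : ℝ) ≤ n * fixCard G (insert c F) := by
          exact_mod_cast fixCard_le_card_mul_fixCard_insert F c
        calc β ^ F.card * (fixCard G F : ℝ)
            ≤ β ^ (insert c F).card * (n * fixCard G (insert c F)) := by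
              have := Finset.card_le_card (Finset.subset_insert c F)
              gcongr
          _ = n * (fixCard G (insert c F) * β ^ (insert c F).card) := by ring
          _ ≤ _ := by gcongr
      intro j
      induction j with
      | zero =>
        obtain ⟨F, hsub, hF, hle⟩ := hext ∅ a
        refine ⟨F, hF, Or.inr ?_, by simpa [fixCard_empty] using hle⟩
        exact Finset.card_pos.2 ⟨a, hsub (by simp)⟩
      | succ j ih =>
        obtain ⟨F, hF, hFc, hle⟩ := ih
        by_cases hFu : F = Finset.univ
        · refine ⟨F, hF, Or.inl hFu, hle.trans ?_⟩
          gcongr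
          · exact_mod_cast hn1
          · omega
        obtain ⟨c, hc⟩ : ∃ c, c ∉ F := by
          by_contra! hcon
          exact hFu (Finset.eq_univ_of_forall hcon)
        obtain ⟨F', hsub, hF', hle'⟩ := hext F c
        have := hF.two_mul_card_le hq hR hne h₁ h₂ h₃ hF' hc hsub
        refine ⟨F', hF', Or.inr ?_, ?_⟩
        · rw [pow_succ]
          have := hFc.resolve_left hFu
          omega
        · calc (Nat.card G : ℝ) ≤ (n : ℝ) ^ (j + 1) * (β ^ F.card * fixCard G F) := hle
            _ ≤ (n : ℝ) ^ (j + 1) * (n * (β ^ F'.card * fixCard G F')) := by gcongr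
            _ = _ := by ring
    obtain ⟨F, -, hF, hle⟩ := key (Nat.log 2 n + 1)
    have hFu : F = Finset.univ := by
      refine hF.resolve_right fun h ↦ ?_
      have h1 := Nat.lt_pow_succ_log_self (b := 2) (by norm_num) n
      have h2 := Finset.card_le_univ F
      rw [Nat.succ_eq_add_one] at h1
      omega
    simpa [hFu, fixCard_univ, ← hn] using hle
  · intro k hk
    have hn0 : (0 : ℝ) < n := by exact_mod_cast hn1
    have hRiff : ∀ (g : G) x y z, R (g • x) (g • y) (g • z) ↔ R x y z := fun g x y z ↦
      ⟨fun h ↦ by simpa using hR g⁻¹ _ _ _ h, hR g x y z⟩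
    have hsep : ∀ x y, x ≠ y →
        q * (n - q) ≤ (Finset.univ.filter fun p : Ω × Ω ↦ R p.1 p.2 x ∧ ¬ R p.1 p.2 y).card := by
      intro x y hxy
      have h := card_filter_eq_card_filter_swap hW hWinv
        (T := fun p w ↦ R p.1 p.2 w.1 ∧ ¬ R p.1 p.2 w.2)
        (fun g p w h ↦ ⟨hR g _ _ _ h.1, fun h' ↦ h.2 ((hRiff g _ _ _).1 h')⟩)
        ((hWmem a b).2 hab) ((hWmem x y).2 hxy)
      have hout : (W.filter fun w ↦ R a b w.1 ∧ ¬ R a b w.2) =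
          (Finset.univ.filter fun z ↦ R a b z) ×ˢ (Finset.univ.filter fun z ↦ ¬ R a b z) := by
        ext ⟨z, w⟩
        simp only [Finset.mem_filter, hWmem, Finset.mem_product, Finset.mem_univ, true_and,
          and_iff_right_iff_imp]
        rintro ⟨hz, hw⟩ rfl
        exact hw hz
      have h4 := Finset.card_filter_add_card_filter_not (s := Finset.univ) (fun z ↦ R a b z)
      rw [h₃ a b hab, Finset.card_univ, ← hn] at h4
      rw [hout, Finset.card_product, h₃ a b hab] at h
      rw [show n - q = (Finset.univ.filter fun z ↦ ¬ R a b z).card by omega, h]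
      exact Finset.card_le_card (Finset.filter_subset_filter _ (Finset.subset_univ _))
    have hqn' : (q : ℝ) * 2 ≤ n := by exact_mod_cast (by omega : q * 2 ≤ n)
    have hε : (q : ℝ) / (2 * n) ≤ 1 := by
      rw [div_le_one (by positivity)]
      linarith
    have hhit : ∀ p : {p : Ω × Ω // p.1 ≠ p.2}, (q : ℝ) / (2 * n) * Fintype.card (Ω × Ω) ≤
        ((Finset.univ.filter fun s : Ω × Ω ↦
          R s.1 s.2 p.1.1 ∧ ¬ R s.1 s.2 p.1.2).card : ℝ) := by
      rintro ⟨⟨x, y⟩, hxy⟩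
      have h5 : ((q * (n - q) : ℕ) : ℝ) ≤ _ := Nat.cast_le.2 (hsep x y hxy)
      refine le_trans ?_ h5
      rw [Fintype.card_prod, ← hn, Nat.cast_mul, Nat.cast_mul, Nat.cast_sub (by omega),
        div_mul_eq_mul_div, div_le_iff₀ (by positivity)]
      have : (0 : ℝ) ≤ q * n := by positivity
      nlinarith
    have hlt : (1 - (q : ℝ) / (2 * n)) ^ k * Fintype.card {p : Ω × Ω // p.1 ≠ p.2} < 1 := by
      refine lt_of_le_of_lt ?_ hk
      have h1 := sub_nonneg.2 hε
      gcongr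
      have := Fintype.card_subtype_le fun p : Ω × Ω ↦ p.1 ≠ p.2
      rw [Fintype.card_prod] at this
      rw [sq]
      exact_mod_cast this
    have : Nonempty (Ω × Ω) := ⟨(a, b)⟩
    obtain ⟨P, hPk, hP⟩ := exists_hitting_finset (A := {p : Ω × Ω // p.1 ≠ p.2})
      (fun (s : Ω × Ω) p ↦ R s.1 s.2 p.1.1 ∧ ¬ R s.1 s.2 p.1.2) hε
      (fun p ↦ by convert hhit p) k hlt
    refine card_le_pow_of_base (P.image Prod.fst ∪ P.image Prod.snd) ?_ hn1 fun g hg ↦ ?_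
    · refine (Finset.card_union_le _ _).trans ?_
      have h6 := Finset.card_image_le (s := P) (f := Prod.fst)
      have h7 := Finset.card_image_le (s := P) (f := Prod.snd)
      omega
    refine eq_of_smul_eq_smul (α := Ω) fun x ↦ ?_
    rw [one_smul]
    by_contra hx
    obtain ⟨⟨u, v⟩, hz, hz1, hz2⟩ := hP ⟨(g • x, x), hx⟩
    apply hz2
    have hu := hg u (Finset.mem_union_left _ (Finset.mem_image_of_mem Prod.fst hz))
    have hv := hg v (Finset.mem_union_right _ (Finset.mem_image_of_mem Prod.snd hz))
    rw [← hRiff g, hu, hv]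
    exact hz1

end Triple

section Descent

variable {d : ℕ}

instance faithfulSMul_ofStabilizer {G Ω : Type*} [Group G] [MulAction G Ω] [FaithfulSMul G Ω]
    (a : Ω) : FaithfulSMul (stabilizer G a) (SubMulAction.ofStabilizer G a) where
  eq_of_smul_eq_smul {g k} h := by
    refine Subtype.ext (eq_of_smul_eq_smul (α := Ω) fun x ↦ ?_)
    by_cases hx : x = a
    · rw [hx, g.2, k.2]
    · exact congrArg Subtype.val (h ⟨x, hx⟩)

theorem card_le_card_mul_card_stabilizer {G Ω : Type*} [Group G] [MulAction G Ω] [Finite G]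
    [Fintype Ω] (a : Ω) : Nat.card G ≤ Fintype.card Ω * Nat.card (stabilizer G a) := by
  classical
  have h := fixCard_le_card_mul_fixCard_insert (G := G) ∅ a
  rw [fixCard_empty] at h
  have h1 : fixCard G {a} = Nat.card (stabilizer G a) := by
    rw [fixCard]
    congr 2
    ext g
    simp [mem_fixingSubgroup_iff]
  rwa [insert_empty_eq, h1] at h

theorem le_card_of_not_isMultiplyPretransitive {G Ω : Type*} [Group G] [MulAction G Ω] [Fintype Ω]
    {k : ℕ} (h : ¬ IsMultiplyPretransitive G Ω k) : k ≤ Fintype.card Ω := by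
  by_contra! hk
  have : IsEmpty (Fin k ↪ Ω) := Function.Embedding.isEmpty_of_card_lt (by simpa using hk)
  exact h ⟨fun x ↦ isEmptyElim x⟩

/-- Multiply transitive groups reduce to groups that are 2-transitive but not 3-transitive. -/
theorem exists_bounds_of_isMultiplyPretransitive (t : ℕ) :
    ∀ {G : Type*} {Ω : Type*} [Group G] [MulAction G Ω] [Fintype Ω] [Finite G] [FaithfulSMul G Ω]
    {m : ℕ}, Fintype.card Ω = m + t → InGamma d G → IsMultiplyPretransitive G Ω (t + 2) →
    ¬ IsMultiplyPretransitive G Ω (t + 3) →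
    ∃ q : ℕ, 0 < q ∧ 2 * q ≤ m ∧
      (∀ b : ℝ, 1 ≤ b → (∀ r, 0 < r → r ≤ q → DegreeBound d r (b ^ r)) →
        (Nat.card G : ℝ) ≤
          (Fintype.card Ω : ℝ) ^ t * ((m : ℝ) ^ (Nat.log 2 m + 2) * b ^ m)) ∧
      (∀ k : ℕ, (1 - (q : ℝ) / (2 * m)) ^ k * (m : ℝ) ^ 2 < 1 →
        Nat.card G ≤ Fintype.card Ω ^ t * m ^ (2 * k)) := by
  induction t with
  | zero =>
    intro G Ω _ _ _ _ _ m hm hG h2 h3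
    have := exists_bounds_of_not_three_transitive hG h2 h3
    rw [hm] at this
    simpa using this
  | succ t ih =>
    intro G Ω _ _ _ _ _ m hm hG h2 h3
    have h4 := le_card_of_not_isMultiplyPretransitive h3
    have h1 : IsPretransitive G Ω := by
      rw [← is_one_pretransitive_iff]
      refine isMultiplyPretransitive_of_le (n := t + 1 + 2) (by omega) ?_
      rw [Nat.card_eq_fintype_card]
      omega
    obtain ⟨a⟩ : Nonempty Ω := Fintype.card_pos_iff.1 (by omega)
    have : Fintype (SubMulAction.ofStabilizer G a) := Fintype.ofFinite _
    have hcard : Fintype.card (SubMulAction.ofStabilizer G a) = m + t := by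
      rw [← Nat.card_eq_fintype_card, SubMulAction.nat_card_ofStabilizer_eq,
        Nat.card_eq_fintype_card, hm]
      omega
    obtain ⟨q, hq, hqm, hb, hk⟩ := ih hcard (hG.subgroup (stabilizer G a))
      (SubMulAction.ofStabilizer.isMultiplyPretransitive.1 h2)
      (mt SubMulAction.ofStabilizer.isMultiplyPretransitive.2 h3)
    have hst := card_le_card_mul_card_stabilizer (G := G) a
    have hle : Fintype.card (SubMulAction.ofStabilizer G a) ≤ Fintype.card Ω := by omega
    refine ⟨q, hq, hqm, fun b hb1 hB ↦ ?_, fun k hk1 ↦ ?_⟩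
    · calc (Nat.card G : ℝ) ≤ Fintype.card Ω * Nat.card (stabilizer G a) := by exact_mod_cast hst
        _ ≤ Fintype.card Ω * ((Fintype.card (SubMulAction.ofStabilizer G a) : ℝ) ^ t *
            ((m : ℝ) ^ (Nat.log 2 m + 2) * b ^ m)) := by gcongr; exact hb b hb1 hB
        _ ≤ Fintype.card Ω * ((Fintype.card Ω : ℝ) ^ t *
            ((m : ℝ) ^ (Nat.log 2 m + 2) * b ^ m)) := by gcongr
        _ = _ := by rw [pow_succ]; ring
    · calc Nat.card G ≤ Fintype.card Ω * Nat.card (stabilizer G a) := hst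
        _ ≤ Fintype.card Ω * (Fintype.card (SubMulAction.ofStabilizer G a) ^ t * m ^ (2 * k)) := by
          gcongr; exact hk k hk1
        _ ≤ Fintype.card Ω * (Fintype.card Ω ^ t * m ^ (2 * k)) := by gcongr
        _ = _ := by rw [pow_succ]; ring

end Descent

section MinimalDegree

theorem exists_card_filter_smul_mem_le {K V : Type*} [Group K] [Fintype K] [MulAction K V]
    [DecidableEq V] {W A B : Finset V} (hW : ∀ p ∈ W, ∀ w ∈ W, ∃ g : K, g • p = w) (hA : A ⊆ W) :
    ∃ k : K, W.card * (A.filter fun a ↦ k • a ∈ B).card ≤ A.card * B.card := by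
  rcases A.eq_empty_or_nonempty with rfl | ⟨a₀, ha₀⟩
  · exact ⟨1, by simp⟩
  by_contra! hcon
  have hswap : ∀ U : Finset V, ∑ k : K, (U.filter fun a ↦ k • a ∈ B).card =
      ∑ a ∈ U, (Finset.univ.filter fun k : K ↦ k • a ∈ B).card := fun U ↦
    Finset.sum_card_bipartiteAbove_eq_sum_card_bipartiteBelow fun (k : K) a ↦ k • a ∈ B
  have hconst : ∀ a ∈ W, (Finset.univ.filter fun k : K ↦ k • a ∈ B).card =
      (Finset.univ.filter fun k : K ↦ k • a₀ ∈ B).card := by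
    intro a ha
    obtain ⟨g, rfl⟩ := hW a₀ (hA ha₀) a ha
    refine Finset.card_bij (fun k _ ↦ k * g) ?_ (fun _ _ _ _ h ↦ mul_right_cancel h) ?_
    · intro k hk
      simpa [mul_smul] using hk
    · intro k hk
      exact ⟨k * g⁻¹, by simpa [mul_smul] using hk, by simp⟩
  have h1 := hswap W
  rw [Finset.sum_congr rfl hconst, Finset.sum_const, smul_eq_mul] at h1
  have h2 := hswap A
  rw [Finset.sum_congr rfl fun a ha ↦ hconst a (hA ha), Finset.sum_const, smul_eq_mul] at h2
  have h3 : ∑ k : K, (W.filter fun a ↦ k • a ∈ B).card ≤ ∑ _k : K, B.card := by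
    refine Finset.sum_le_sum fun k _ ↦ ?_
    refine Finset.card_le_card_of_injOn (k • ·) (fun a ha ↦ ?_) (MulAction.injective k).injOn
    exact (Finset.mem_filter.1 ha).2
  have h4 : ∑ _k : K, A.card * B.card < ∑ k : K, W.card * (A.filter fun a ↦ k • a ∈ B).card :=
    Finset.sum_lt_sum_of_nonempty ⟨1, Finset.mem_univ _⟩ fun k _ ↦ hcon k
  rw [← Finset.mul_sum, ← Finset.mul_sum, h2, mul_left_comm, ← h1] at h4
  exact absurd h4 (not_lt.2 (Nat.mul_le_mul_left _ h3))

variable {Ω : Type*} [Fintype Ω] [DecidableEq Ω]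

theorem card_support_commutator_le (g h : Equiv.Perm Ω) :
    (g * h * g⁻¹ * h⁻¹).support.card ≤ 3 * (g.support ∩ h.support).card := by
  set I := g.support ∩ h.support with hI
  have hsub : (g * h * g⁻¹ * h⁻¹).support ⊆ I ∪ I.map g.toEmbedding ∪ I.map h.toEmbedding := by
    intro x hx
    have happly : ∀ (f : Equiv.Perm Ω) y, f (f⁻¹ y) = y := fun f y ↦ f.apply_symm_apply y
    have hgx : ∀ y, g⁻¹ y ∈ g.support ↔ y ∈ g.support := fun y ↦ by
      rw [← Equiv.Perm.apply_mem_support, happly]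
    have hhx : ∀ y, h⁻¹ y ∈ h.support ↔ y ∈ h.support := fun y ↦ by
      rw [← Equiv.Perm.apply_mem_support, happly]
    have hg' : ∀ y, y ∉ g.support → g⁻¹ y = y := fun y hy ↦ by
      rw [Equiv.Perm.inv_eq_iff_eq, Equiv.Perm.notMem_support.1 hy]
    have hh' : ∀ y, y ∉ h.support → h⁻¹ y = y := fun y hy ↦ by
      rw [Equiv.Perm.inv_eq_iff_eq, Equiv.Perm.notMem_support.1 hy]
    have hmap : ∀ (f : Equiv.Perm Ω), f⁻¹ x ∈ I → x ∈ I.map f.toEmbedding := fun f hf ↦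
      Finset.mem_map.2 ⟨f⁻¹ x, hf, by simp⟩
    rw [Equiv.Perm.mem_support] at hx
    simp only [Equiv.Perm.mul_apply] at hx
    simp only [Finset.mem_union]
    by_cases hT : x ∈ h.support
    · by_cases hS : x ∈ g.support
      · exact Or.inl (Or.inl (Finset.mem_inter.2 ⟨hS, hT⟩))
      · refine Or.inr (hmap h (Finset.mem_inter.2 ⟨?_, (hhx x).2 hT⟩))
        by_contra hc
        rw [hg' _ hc, happly, Equiv.Perm.notMem_support.1 hS] at hx
        exact hx rfl
    · rw [hh' x hT] at hx
      have hT' : g⁻¹ x ∈ h.support := by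
        by_contra hc
        rw [Equiv.Perm.notMem_support.1 hc, happly] at hx
        exact hx rfl
      refine Or.inl (Or.inr (hmap g (Finset.mem_inter.2 ⟨?_, hT'⟩)))
      by_contra hc
      rw [hgx] at hc
      rw [hg' x hc] at hT'
      exact hT hT'
  refine (Finset.card_le_card hsub).trans ?_
  refine (Finset.card_union_le _ _).trans ?_
  have := Finset.card_union_le I (I.map g.toEmbedding)
  rw [Finset.card_map] at this ⊢
  omega

/-- The minimal degree of a 3-transitive group not containing the alternating group is at least
a quarter of the degree. -/
theorem card_le_four_mul_card_support {G : Subgroup (Equiv.Perm Ω)}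
    (h2 : IsMultiplyPretransitive G Ω 2) (h3 : IsMultiplyPretransitive G Ω 3)
    (hA : ¬ alternatingGroup Ω ≤ G) {g₀ : Equiv.Perm Ω} (hg₀ : g₀ ∈ G) (hne : g₀ ≠ 1) :
    Fintype.card Ω ≤ 4 * g₀.support.card := by
  classical
  obtain ⟨g, hg, hmin⟩ := Finset.exists_min_image
    ((Finset.univ : Finset (Equiv.Perm Ω)).filter fun g ↦ g ∈ G ∧ g ≠ 1)
    (fun g ↦ g.support.card) ⟨g₀, by simp [hg₀, hne]⟩
  simp only [Finset.mem_filter, Finset.mem_univ, true_and] at hg hmin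
  refine le_trans ?_ (Nat.mul_le_mul_left 4 (hmin g₀ ⟨hg₀, hne⟩))
  obtain ⟨hgG, hg1⟩ := hg
  by_contra! hlt
  set S := g.support with hS
  have hprim : IsPreprimitive G Ω := isPreprimitive_of_is_two_pretransitive h2
  have hS2 : 2 ≤ S.card := Equiv.Perm.two_le_card_support_of_ne_one hg1
  have hSne2 : S.card ≠ 2 := fun h ↦ by
    have := Equiv.Perm.subgroup_eq_top_of_isPreprimitive_of_isSwap_mem hprim g
      (Equiv.Perm.card_support_eq_two.1 h) hgG
    exact hA (this ▸ le_top)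
  have hSne3 : S.card ≠ 3 := fun h ↦ hA
    (Equiv.Perm.alternatingGroup_le_of_isPreprimitive_of_isThreeCycle_mem hprim
      (card_support_eq_three_iff.1 h) hgG)
  obtain ⟨α, hα⟩ : S.Nonempty := Finset.card_pos.1 (by omega)
  set β := g α with hβ
  have hαβ : α ≠ β := (Equiv.Perm.mem_support.1 hα).symm
  have hβS : β ∈ S := Equiv.Perm.apply_mem_support.2 hα
  obtain ⟨δ, hδ⟩ : ∃ δ, δ ∉ S := by
    by_contra! hcon
    have := Finset.eq_univ_of_forall hcon
    rw [this, Finset.card_univ] at hlt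
    omega
  have hαδ : α ≠ δ := fun h ↦ hδ (h ▸ hα)
  obtain ⟨x, hxα, hxδ⟩ := is_two_pretransitive_iff.1 h2 hαδ hαβ
  set f : Equiv.Perm Ω := x.1 * g * x.1⁻¹ with hf
  have hfS : f.support = S.map x.1.toEmbedding := Equiv.Perm.support_conj
  have hfcard : f.support.card = S.card := by rw [hfS, Finset.card_map]
  have hfα : α ∈ f.support := by
    rw [hfS]; exact Finset.mem_map.2 ⟨α, hα, hxα⟩
  have hfβ : β ∉ f.support := by
    rw [hfS]
    intro h
    obtain ⟨y, hy, hyβ⟩ := Finset.mem_map.1 h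
    have : y = δ := x.1.injective (hyβ.trans hxδ.symm)
    exact hδ (this ▸ hy)
  let K := fixingSubgroup G ({α, β} : Set Ω)
  have hKfix : ∀ k : K, k • α = α ∧ k • β = β := fun k ↦
    ⟨(mem_fixingSubgroup_iff G).1 k.2 α (by simp), (mem_fixingSubgroup_iff G).1 k.2 β (by simp)⟩
  have hKtrans : ∀ p ∈ (Finset.univ \ {α, β} : Finset Ω), ∀ w ∈ (Finset.univ \ {α, β} : Finset Ω),
      ∃ k : K, k • p = w := by
    intro p hp w hw
    simp only [Finset.mem_sdiff, Finset.mem_univ, true_and, Finset.mem_insert,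
      Finset.mem_singleton, not_or] at hp hw
    have hinj : ∀ v : Ω, v ≠ α ∧ v ≠ β → Function.Injective ![α, β, v] := by
      intro v hv i j hij
      obtain ⟨hvα, hvβ⟩ := hv
      fin_cases i <;> fin_cases j <;> first | rfl | (exfalso; revert hij)
      exacts [hαβ, hvα.symm, hαβ.symm, hvβ.symm, hvα, hvβ]
    obtain ⟨k, hk⟩ := h3.exists_smul_eq ⟨_, hinj p hp⟩ ⟨_, hinj w hw⟩
    have hk' : ∀ i, k • (![α, β, p] i) = ![α, β, w] i := fun i ↦ DFunLike.congr_fun hk i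
    refine ⟨⟨k, ?_⟩, hk' 2⟩
    rw [mem_fixingSubgroup_iff]
    rintro y (rfl | rfl)
    · exact hk' 0
    · exact hk' 1
  obtain ⟨k, hk⟩ := exists_card_filter_smul_mem_le (K := K) (A := S \ {α, β})
    (B := f.support.erase α) hKtrans (Finset.sdiff_subset_sdiff (Finset.subset_univ _) subset_rfl)
  set kk : Equiv.Perm Ω := ((k : G) : Equiv.Perm Ω) with hkk
  set h : Equiv.Perm Ω := kk⁻¹ * f * kk with hh
  have hkα : kk α = α := (hKfix k).1
  have hkβ : kk β = β := (hKfix k).2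
  have hhmem : ∀ y, y ∈ h.support ↔ kk y ∈ f.support := by
    intro y
    simp only [Equiv.Perm.mem_support, hh, Equiv.Perm.mul_apply, ne_eq, Equiv.Perm.inv_eq_iff_eq]
  have hhG : h ∈ G := G.mul_mem (G.mul_mem (G.inv_mem k.1.2)
    (G.mul_mem (G.mul_mem x.2 hgG) (G.inv_mem x.2))) k.1.2
  have hcomm : g * h * g⁻¹ * h⁻¹ ≠ 1 := by
    intro h1
    have h1' : g * h = h * g := by
      rw [mul_inv_eq_one, mul_inv_eq_iff_eq_mul] at h1
      exact h1
    have hα' : h α ≠ α := Equiv.Perm.mem_support.1 ((hhmem α).2 (by rwa [hkα]))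
    have hβ' : h β = β := Equiv.Perm.notMem_support.1 (fun h2 ↦ hfβ (by
      have := (hhmem β).1 h2; rwa [hkβ] at this))
    apply hα'
    apply g.injective
    have := DFunLike.congr_fun h1' α
    simp only [Equiv.Perm.mul_apply] at this
    rw [this, ← hβ, hβ']
  have hμ := (hmin _ ⟨G.mul_mem (G.mul_mem (G.mul_mem hgG hhG) (G.inv_mem hgG)) (G.inv_mem hhG),
    hcomm⟩).trans (card_support_commutator_le g h)
  have hinter : (S ∩ h.support).card ≤
      1 + ((S \ {α, β}).filter fun a ↦ k • a ∈ f.support.erase α).card := by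
    rw [add_comm]
    refine (Finset.card_le_card ?_).trans (Finset.card_insert_le α _)
    intro y hy
    obtain ⟨hyS, hyh⟩ := Finset.mem_inter.1 hy
    have hyf := (hhmem y).1 hyh
    by_cases hyα : y = α
    · exact hyα ▸ Finset.mem_insert_self _ _
    refine Finset.mem_insert_of_mem (Finset.mem_filter.2 ⟨?_, Finset.mem_erase.2 ⟨?_, hyf⟩⟩)
    · simp only [Finset.mem_sdiff, hyS, Finset.mem_insert, Finset.mem_singleton, not_or, hyα,
        not_false_eq_true, true_and]
      rintro rfl
      rw [hkβ] at hyf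
      exact hfβ hyf
    · intro hc
      exact hyα (kk.injective (hc.trans hkα.symm))
  have hpair : ({α, β} : Finset Ω).card = 2 := Finset.card_pair hαβ
  have hc1 : (Finset.univ \ {α, β} : Finset Ω).card = Fintype.card Ω - 2 := by
    rw [Finset.card_sdiff_of_subset (Finset.subset_univ _), hpair, Finset.card_univ]
  have hc2 : (S \ {α, β}).card = S.card - 2 := by
    rw [Finset.card_sdiff_of_subset, hpair]
    intro y hy
    rcases Finset.mem_insert.1 hy with rfl | hy
    · exact hα
    · exact Finset.mem_singleton.1 hy ▸ hβS
  rw [hc1, hc2, Finset.card_erase_of_mem hfα, hfcard] at hk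
  set j := ((S \ {α, β}).filter fun a ↦ k • a ∈ f.support.erase α).card
  have hμ' : S.card ≤ 3 * (1 + j) := hμ.trans (Nat.mul_le_mul_left 3 hinter)
  obtain ⟨m, hm⟩ := Nat.exists_eq_add_of_le (show 4 ≤ S.card by omega)
  obtain ⟨l, hl⟩ := Nat.exists_eq_add_of_le (show 4 * S.card + 1 ≤ Fintype.card Ω by omega)
  rw [hl, hm, show 4 * (4 + m) + 1 + l - 2 = 15 + 4 * m + l by omega,
    show 4 + m - 2 = 2 + m by omega, show 4 + m - 1 = 3 + m by omega] at hk
  rw [hm] at hμ'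
  rcases j with _ | j
  · omega
  · nlinarith [Nat.zero_le (l * j), Nat.zero_le (m * j)]

end MinimalDegree

section TransitivityDegree

theorem two_pow_card_le_of_prime_dvd {Q : Finset ℕ} (hQ : ∀ p ∈ Q, p.Prime) {l : ℕ} (hl : 0 < l)
    (h : ∀ p ∈ Q, p ∣ l) : 2 ^ Q.card ≤ l := by
  have h1 : ∏ p ∈ Q, p ∣ l :=
    Finset.prod_primes_dvd l (fun p hp ↦ (hQ p hp).prime) h
  refine le_trans ?_ (Nat.le_of_dvd hl h1)
  exact Finset.pow_card_le_prod _ _ _ fun p hp ↦ (hQ p hp).two_le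

variable {Ω : Type*} [Fintype Ω] [DecidableEq Ω]

/-- A 3-transitive group of degree `n` not containing the alternating group cannot be
`∑ p ∈ Q, p`-transitive for a set `Q` of more than `4 log₂ n` primes. -/
theorem card_le_four_mul_log_of_isMultiplyPretransitive {G : Subgroup (Equiv.Perm Ω)}
    (h2 : IsMultiplyPretransitive G Ω 2) (h3 : IsMultiplyPretransitive G Ω 3)
    (hA : ¬ alternatingGroup Ω ≤ G) {Q : Finset ℕ} (hQ : ∀ p ∈ Q, p.Prime)
    (hΩ : ∑ p ∈ Q, p ≤ Fintype.card Ω) (hpos : 0 < Fintype.card Ω)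
    (ht : IsMultiplyPretransitive G Ω (∑ p ∈ Q, p)) :
    Q.card ≤ 4 * Nat.log 2 (Fintype.card Ω) := by
  set n := Fintype.card Ω with hn
  let I := Σ p : Q, ZMod p.1
  have hfin : ∀ p : Q, NeZero p.1 := fun p ↦ ⟨(hQ p.1 p.2).ne_zero⟩
  have hcardI : Fintype.card I = ∑ p ∈ Q, p := by
    simp only [I, Fintype.card_sigma, ZMod.card]
    exact Finset.sum_coe_sort Q fun p ↦ p
  let e₀ : Fin (∑ p ∈ Q, p) ≃ I := (Fintype.equivFinOfCardEq hcardI).symm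
  obtain ⟨e⟩ : Nonempty (I ↪ Ω) := Function.Embedding.nonempty_of_card_le (by omega)
  let σ : I → I := fun i ↦ ⟨i.1, i.2 + 1⟩
  have hσ : Function.Injective σ := by
    rintro ⟨p, a⟩ ⟨p', a'⟩ h
    obtain rfl : p = p' := congrArg Sigma.fst h
    obtain rfl : a = a' := add_right_cancel (eq_of_heq (Sigma.mk.inj h).2)
    rfl
  obtain ⟨g, hg⟩ := ht.exists_smul_eq (e₀.toEmbedding.trans e)
    (e₀.toEmbedding.trans (Function.Embedding.trans ⟨σ, hσ⟩ e))
  have hcycle : ∀ (p : Q) (a : ZMod p.1), g • e ⟨p, a⟩ = e ⟨p, a + 1⟩ := by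
    intro p a
    have := DFunLike.congr_fun hg (e₀.symm ⟨p, a⟩)
    simpa [σ] using this
  have hiter : ∀ (p : Q) (j : ℕ), g ^ j • e ⟨p, 0⟩ = e ⟨p, (j : ZMod p.1)⟩ := by
    intro p j
    induction j with
    | zero => simp
    | succ j ih => rw [pow_succ', mul_smul, ih, hcycle, Nat.cast_succ]
  have hord : orderOf g ≠ 0 := (orderOf_pos g).ne'
  let H : ℕ → Equiv.Perm Ω := fun p ↦ ((g ^ (ordCompl[p] (orderOf g)) : G) : Equiv.Perm Ω)
  have hH1 : ∀ p ∈ Q, H p ≠ 1 := by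
    intro p hp h
    have h' : g ^ (ordCompl[p] (orderOf g)) = 1 := Subtype.ext h
    have := hiter ⟨p, hp⟩ (ordCompl[p] (orderOf g))
    rw [h', one_smul] at this
    have h4 := eq_of_heq (Sigma.mk.inj (e.injective this)).2
    refine Nat.not_dvd_ordCompl (hQ p hp) hord ?_
    exact (ZMod.natCast_eq_zero_iff _ _).1 h4.symm
  have hmove : ∀ p x, x ∈ (H p).support → p ∣ period g x := by
    intro p x hx
    by_contra hc
    have h4 := Nat.dvd_ordCompl_of_dvd_not_dvd (period_dvd_orderOf g x) hc
    have h5 : g ^ (ordCompl[p] (orderOf g)) • x = x := pow_smul_eq_iff_period_dvd.2 h4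
    exact Equiv.Perm.mem_support.1 hx h5
  have hsum := Finset.sum_card_bipartiteAbove_eq_sum_card_bipartiteBelow (s := Q)
    (t := (Finset.univ : Finset Ω)) fun p x ↦ x ∈ (H p).support
  have hlow : Q.card * n ≤ 4 *
      ∑ p ∈ Q, (Finset.univ.filter fun x ↦ x ∈ (H p).support).card := by
    rw [Finset.mul_sum, ← smul_eq_mul]
    refine Finset.card_nsmul_le_sum _ _ _ fun p hp ↦ ?_
    rw [Finset.filter_univ_mem]
    exact card_le_four_mul_card_support h2 h3 hA (SetLike.coe_mem _) (hH1 p hp)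
  have hup : ∑ x : Ω, (Q.filter fun p ↦ x ∈ (H p).support).card ≤ n * Nat.log 2 n := by
    rw [← smul_eq_mul]
    refine Finset.sum_le_card_nsmul _ _ _ fun x _ ↦ ?_
    refine Nat.le_log_of_pow_le (by norm_num) ?_
    refine (two_pow_card_le_of_prime_dvd (l := period g x)
      (fun p hp ↦ hQ p (Finset.mem_filter.1 hp).1) ?_
      fun p hp ↦ hmove p x (Finset.mem_filter.1 hp).2).trans ?_
    · exact period_pos_of_orderOf_pos (orderOf_pos g) x
    · rw [period_eq_minimalPeriod]
      exact Function.minimalPeriod_le_card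
  simp only [Finset.bipartiteAbove, Finset.bipartiteBelow] at hsum
  rw [hsum] at hlow
  refine Nat.le_of_mul_le_mul_right ?_ hpos
  linarith

/-- A `t`-transitive group of degree `n` not containing the alternating group has `t < y ^ 2` as
soon as there are more than `4 log₂ n` primes up to `y`. -/
theorem lt_sq_of_isMultiplyPretransitive {G : Subgroup (Equiv.Perm Ω)}
    (hA : ¬ alternatingGroup Ω ≤ G) {t y : ℕ} (ht : IsMultiplyPretransitive G Ω t)
    (htn : t ≤ Fintype.card Ω) (hy2 : 2 ≤ y)
    (hy : 4 * Nat.log 2 (Fintype.card Ω) < Nat.primeCounting y) : t < y ^ 2 := by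
  by_contra! hle
  have hmono : ∀ k ≤ t, IsMultiplyPretransitive G Ω k := fun k hk ↦
    isMultiplyPretransitive_of_le (n := t) hk (by rwa [Nat.card_eq_fintype_card])
  set Q := (Finset.range (y + 1)).filter Nat.Prime with hQ
  have hQcard : Q.card = Nat.primeCounting y := by
    rw [Nat.primeCounting, Nat.primeCounting', Nat.count_eq_card_filter_range]
  have hQle : Q.card ≤ y := by
    have : Q ⊆ Finset.Icc 1 y := by
      intro p hp
      obtain ⟨h1, h2⟩ := Finset.mem_filter.1 hp
      exact Finset.mem_Icc.2 ⟨h2.one_le, by simpa [Nat.lt_succ_iff] using h1⟩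
    simpa using Finset.card_le_card this
  have hsum : ∑ p ∈ Q, p ≤ t := by
    refine le_trans ?_ hle
    refine (Finset.sum_le_card_nsmul Q _ y fun p hp ↦ ?_).trans ?_
    · simpa [Nat.lt_succ_iff] using (Finset.mem_filter.1 hp).1
    · rw [smul_eq_mul, sq]
      exact Nat.mul_le_mul_right _ hQle
  have h4 : 4 ≤ t := le_trans (by nlinarith) hle
  have := card_le_four_mul_log_of_isMultiplyPretransitive (hmono 2 (by omega))
    (hmono 3 (by omega)) hA (fun p hp ↦ (Finset.mem_filter.1 hp).2) (hsum.trans htn) (by omega)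
    (hmono _ hsum)
  rw [← hQ] at this
  omega

end TransitivityDegree

section Primitive

theorem exists_pow_eq_and_log_le :
    ∃ N : ℕ, ∀ n : ℕ, N ≤ n → ∃ z : ℝ, 100 ≤ z ∧ z ^ 32 = n ∧ Real.log n ≤ z := by
  have h1 : ∀ᶠ x : ℝ in Filter.atTop, ‖Real.log x‖ ≤ 1 * ‖x ^ (1 / 32 : ℝ)‖ :=
    (isLittleO_log_rpow_atTop (by norm_num)).bound one_pos
  have h2 : ∀ᶠ x : ℝ in Filter.atTop, (100 : ℝ) ≤ x ^ (1 / 32 : ℝ) :=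
    (tendsto_rpow_atTop (by norm_num)).eventually_ge_atTop 100
  obtain ⟨N, hN⟩ := Filter.eventually_atTop.1
    (tendsto_natCast_atTop_atTop.eventually (h1.and h2))
  refine ⟨N, fun n hn ↦ ⟨(n : ℝ) ^ (1 / 32 : ℝ), (hN n hn).2, ?_, ?_⟩⟩
  · rw [← Real.rpow_natCast, ← Real.rpow_mul (by positivity)]
    norm_num
  · have := (hN n hn).1
    rw [one_mul, Real.norm_of_nonneg (by positivity : (0 : ℝ) ≤ (n : ℝ) ^ (1 / 32 : ℝ))] at this
    exact (le_abs_self _).trans this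

theorem four_mul_log_lt_primeCounting {n : ℕ} {z : ℝ} (hz : 100 ≤ z) (hzn : z ^ 32 = n)
    (hlog : Real.log n ≤ z) : 4 * Nat.log 2 n < Nat.primeCounting ⌊z ^ 4⌋₊ := by
  set y := ⌊z ^ 4⌋₊ with hy
  have hy1 : (y : ℝ) ≤ z ^ 4 := Nat.floor_le (by positivity)
  have hy2 : z ^ 4 < y + 1 := Nat.lt_floor_add_one _
  have hz4 : (100 : ℝ) ^ 3 * z ≤ z ^ 4 := by
    rw [pow_succ z 3]; gcongr
  have hyn : (y : ℝ) + 1 ≤ n := by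
    have : z ^ 5 ≤ z ^ 32 := pow_le_pow_right₀ (by linarith) (by norm_num)
    rw [← hzn]
    have : z ^ 4 * 100 ≤ z ^ 5 := by rw [pow_succ z 4]; gcongr
    nlinarith
  have hlog1 : Real.log (y + 1) ≤ z :=
    (Real.log_le_log (by positivity) hyn).trans hlog
  have hlog2 : Real.log y ≤ z :=
    (Real.log_le_log (by nlinarith) (by linarith)).trans hlog1
  have hlog0 : 0 < Real.log y := Real.log_pos (by nlinarith)
  have hl2 := Real.log_two_gt_d9
  have hpi := Chebyshev.pi_ge y
  rw [div_le_iff₀ hlog0] at hpi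
  have h3 : (Nat.log 2 n : ℝ) ≤ 2 * z := by
    have := Real.natLog_le_logb n 2
    rw [Real.logb, Nat.cast_ofNat, le_div_iff₀ (by linarith)] at this
    nlinarith [(Nat.cast_nonneg (Nat.log 2 n) : (0 : ℝ) ≤ _)]
  have h4 : (4 * Nat.log 2 n : ℝ) < Nat.primeCounting y := by
    refine lt_of_le_of_lt (mul_le_mul_of_nonneg_left h3 (by norm_num)) ?_
    refine lt_of_mul_lt_mul_right (a := z) ?_ (by linarith)
    have h5 : (Nat.primeCounting y : ℝ) * Real.log y ≤ Nat.primeCounting y * z := by gcongr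
    have h6 : z ^ 2 * 100 ^ 2 ≤ z ^ 4 := by
      rw [show z ^ 4 = z ^ 2 * z ^ 2 by ring]; gcongr
    nlinarith
  exact_mod_cast h4

theorem exists_pow_mul_sq_lt_one {n : ℕ} {z : ℝ} (hz : 100 ≤ z) (hzn : z ^ 32 = n)
    (hlog : Real.log n ≤ z) : ∃ k : ℕ, (k : ℝ) ≤ 4 * z ^ 17 + 1 ∧
      ∀ r : ℝ, 1 / (2 * z ^ 16) ≤ r → r ≤ 1 → (1 - r) ^ k * (n : ℝ) ^ 2 < 1 := by
  have hz0 : 0 < z := by linarith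
  have hn : (0 : ℝ) < n := by rw [← hzn]; positivity
  refine ⟨⌊4 * z ^ 17⌋₊ + 1, ?_, fun r hr hr1 ↦ ?_⟩
  · push_cast
    gcongr
    exact Nat.floor_le (by positivity)
  · set k := ⌊4 * z ^ 17⌋₊ + 1
    have hk : 4 * z ^ 17 < k := by simpa [k] using Nat.lt_floor_add_one (4 * z ^ 17)
    have h1 : 2 * z < r * k := by
      calc 2 * z = 1 / (2 * z ^ 16) * (4 * z ^ 17) := by field_simp; ring
        _ < 1 / (2 * z ^ 16) * k := by gcongr
        _ ≤ r * k := by gcongr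
    calc (1 - r) ^ k * (n : ℝ) ^ 2 ≤ Real.exp (-r) ^ k * Real.exp (Real.log n) ^ 2 := by
          rw [Real.exp_log hn]
          gcongr
          · have := Real.add_one_le_exp (-r)
            linarith
      _ = Real.exp (k * (-r) + 2 * Real.log n) := by
          rw [← Real.exp_nat_mul, ← Real.exp_nat_mul, ← Real.exp_add]
          norm_num
      _ < 1 := by
          rw [Real.exp_lt_one_iff]
          linarith

theorem pow_pred_le_rpow_pow {c : ℝ} (hc : 1 ≤ c) {q r : ℕ} (hr : 0 < r) (hrq : r ≤ q) :
    c ^ (r - 1) ≤ (c ^ (1 - 1 / (q : ℝ))) ^ r := by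
  rw [← Real.rpow_natCast, ← Real.rpow_natCast, ← Real.rpow_mul (by linarith)]
  refine Real.rpow_le_rpow_of_exponent_le hc ?_
  have hq : (0 : ℝ) < q := by exact_mod_cast hr.trans_le hrq
  rw [Nat.cast_pred hr, sub_mul, one_mul]
  gcongr
  rw [div_mul_eq_mul_div, one_mul, div_le_one hq]
  exact_mod_cast hrq

theorem DegreeBound.mono {d m : ℕ} {A B : ℝ} (h : DegreeBound d m A) (hAB : A ≤ B) :
    DegreeBound d m B := fun H hH ↦ (h H hH).trans hAB

theorem rpow_pow_eq {c : ℝ} (hc : 0 < c) (q n : ℕ) :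
    (c ^ (1 - 1 / (q : ℝ))) ^ n = c ^ ((n : ℝ) - n / q) := by
  rw [← Real.rpow_natCast, ← Real.rpow_mul hc.le]
  ring_nf

theorem natCast_pow_le_rpow {c z : ℝ} (hc : Real.exp 1 ≤ c) {m n : ℕ} (hm : 0 < m) (hmn : m ≤ n)
    (hlog : Real.log n ≤ z) (k : ℕ) : (m : ℝ) ^ k ≤ c ^ (z * k) := by
  have hm0 : (0 : ℝ) < m := by exact_mod_cast hm
  have hz : Real.log m ≤ z := (Real.log_le_log hm0 (by exact_mod_cast hmn)).trans hlog
  have hz0 : 0 ≤ z := (Real.log_natCast_nonneg m).trans hz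
  rw [Real.rpow_mul ((Real.exp_pos 1).le.trans hc), Real.rpow_natCast]
  gcongr
  calc (m : ℝ) = Real.exp (Real.log m) := (Real.exp_log hm0).symm
    _ ≤ Real.exp z := Real.exp_le_exp.2 hz
    _ = Real.exp 1 ^ z := (Real.exp_one_rpow z).symm
    _ ≤ c ^ z := by gcongr

theorem rpow_le_pow_pred {c e : ℝ} (hc : Real.exp 1 ≤ c) {n : ℕ} (hn : 0 < n)
    (he : e ≤ n - 1) : c ^ e ≤ c ^ (n - 1) := by
  rw [← Real.rpow_natCast, Nat.cast_pred hn]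
  exact Real.rpow_le_rpow_of_exponent_le ((Real.one_le_exp zero_le_one).trans hc) he

variable {Ω : Type*} [Fintype Ω]

theorem card_le_pow_of_not_two_transitive {d : ℕ} {G : Subgroup (Equiv.Perm Ω)} {c z : ℝ}
    (hc : Real.exp 1 ≤ c) (hz : 100 ≤ z) (hzn : z ^ 32 = Fintype.card Ω)
    (hlog : Real.log (Fintype.card Ω) ≤ z) [IsPreprimitive G Ω] (hG : InGamma d G)
    (hB : ∀ r, 0 < r → r < Fintype.card Ω → DegreeBound d r (c ^ (r - 1)))
    (h2 : ¬ IsMultiplyPretransitive G Ω 2) :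
    (Nat.card G : ℝ) ≤ c ^ (Fintype.card Ω - 1) := by
  have hc1 : 1 ≤ c := (Real.one_le_exp zero_le_one).trans hc
  have hc0 : 0 < c := by linarith
  have hz0 : 0 < z := by linarith
  have hn0 : (0 : ℝ) < Fintype.card Ω := by rw [← hzn]; positivity
  have hn' : 0 < Fintype.card Ω := by exact_mod_cast hn0
  obtain ⟨q, hq, hqn, hb, hk⟩ := exists_bounds_of_not_two_transitive hG h2 hn'
  set n := Fintype.card Ω with hn
  have hq0 : (0 : ℝ) < q := by exact_mod_cast hq
  have hqn' : 2 * (q : ℝ) ≤ n := by exact_mod_cast hqn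
  by_cases hqz : (q : ℝ) ≤ z ^ 24
  · refine (hb (c ^ (1 - 1 / (q : ℝ))) (Real.one_le_rpow hc1 ?_) fun r hr hrq ↦ ?_).trans ?_
    · rw [sub_nonneg, div_le_one hq0]
      exact_mod_cast hq
    · exact (hB r hr (by omega)).mono (pow_pred_le_rpow_pow hc1 hr hrq)
    · have h1 := natCast_pow_le_rpow hc hn' le_rfl hlog 1
      rw [rpow_pow_eq hc0]
      calc (n : ℝ) * c ^ ((n : ℝ) - n / q) ≤ c ^ (z * (1 : ℕ)) * c ^ ((n : ℝ) - n / q) := by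
            gcongr
            simpa using h1
        _ = c ^ (z * (1 : ℕ) + (n - n / q)) := (Real.rpow_add hc0 _ _).symm
        _ ≤ c ^ (n - 1) := by
          refine rpow_le_pow_pred hc hn' ?_
          have h3 : z ^ 8 ≤ n / q := by
            rw [le_div_iff₀ hq0, ← hzn, show z ^ 32 = z ^ 8 * z ^ 24 by ring]
            gcongr
          have h4 : z * 100 ^ 7 ≤ z ^ 8 := by
            rw [show z ^ 8 = z * z ^ 7 by ring]; gcongr
          push_cast
          nlinarith
  · push Not at hqz
    obtain ⟨k, hkz, hkr⟩ := exists_pow_mul_sq_lt_one hz hzn hlog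
    have h1 : (Nat.card G : ℝ) ≤ (n : ℝ) ^ k := by
      refine mod_cast hk k (hkr _ ?_ ?_)
      · rw [← hzn, div_le_div_iff₀ (by positivity) (by positivity)]
        calc 1 * (2 * (z ^ 32) ^ 2) = (z ^ 24) ^ 2 * (2 * z ^ 16) := by ring
          _ ≤ q ^ 2 * (2 * z ^ 16) := by gcongr
      · rw [div_le_one (by positivity)]
        nlinarith
    refine h1.trans ((natCast_pow_le_rpow hc hn' le_rfl hlog k).trans
      (rpow_le_pow_pred hc hn' ?_))
    calc z * k ≤ z * (4 * z ^ 17 + 1) := by gcongr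
      _ ≤ n - 1 := by
        rw [← hzn]
        have h3 : z ^ 18 * 100 ^ 14 ≤ z ^ 32 := by
          rw [show z ^ 32 = z ^ 18 * z ^ 14 by ring]; gcongr
        have h4 : z * 100 ^ 17 ≤ z ^ 18 := by
          rw [show z ^ 18 = z * z ^ 17 by ring]; gcongr
        nlinarith

theorem card_le_pow_of_two_transitive [DecidableEq Ω] {d : ℕ} {G : Subgroup (Equiv.Perm Ω)}
    {c z : ℝ} (hc : Real.exp 1 ≤ c) (hz : 100 ≤ z) (hzn : z ^ 32 = Fintype.card Ω)
    (hlog : Real.log (Fintype.card Ω) ≤ z) (hG : InGamma d G) (hA : ¬ alternatingGroup Ω ≤ G)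
    (hB : ∀ r, 0 < r → r < Fintype.card Ω → DegreeBound d r (c ^ (r - 1)))
    (h2 : IsMultiplyPretransitive G Ω 2) :
    (Nat.card G : ℝ) ≤ c ^ (Fintype.card Ω - 1) := by
  classical
  have hc1 : 1 ≤ c := (Real.one_le_exp zero_le_one).trans hc
  have hc0 : 0 < c := by linarith
  have hz0 : 0 < z := by linarith
  have hn0 : (0 : ℝ) < Fintype.card Ω := by rw [← hzn]; positivity
  have hn' : 0 < Fintype.card Ω := by exact_mod_cast hn0
  have hlt := four_mul_log_lt_primeCounting hz hzn hlog
  set y := ⌊z ^ 4⌋₊ with hy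
  have hyz : (y : ℝ) ≤ z ^ 4 := Nat.floor_le (by positivity)
  have hzn8 : z ^ 8 * 100 ^ 24 ≤ Fintype.card Ω := by
    rw [← hzn, show z ^ 32 = z ^ 8 * z ^ 24 by ring]; gcongr
  have hz8 : z * 100 ^ 7 ≤ z ^ 8 := by
    rw [show z ^ 8 = z * z ^ 7 by ring]; gcongr
  have hy2 : 2 ≤ y := Nat.le_floor (by
    have : (100 : ℝ) ^ 4 ≤ z ^ 4 := by gcongr
    norm_num at this ⊢
    linarith)
  have hyn : y ^ 2 ≤ Fintype.card Ω := by
    have h1 : (y : ℝ) ^ 2 ≤ (z ^ 4) ^ 2 := by gcongr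
    have : (y : ℝ) ^ 2 ≤ Fintype.card Ω := by nlinarith
    exact_mod_cast this
  have hex : ∃ t, ¬ IsMultiplyPretransitive G Ω (t + 3) := by
    refine ⟨y ^ 2 - 3, fun h ↦ ?_⟩
    rw [Nat.sub_add_cancel (by nlinarith)] at h
    exact (lt_sq_of_isMultiplyPretransitive hA h hyn hy2 hlt).false
  obtain ⟨s, hs, hmin⟩ : ∃ s, ¬ IsMultiplyPretransitive G Ω (s + 3) ∧
      IsMultiplyPretransitive G Ω (s + 2) := by
    refine ⟨Nat.find hex, Nat.find_spec hex, ?_⟩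
    rcases h : Nat.find hex with _ | s
    · exact h2
    · exact not_not.1 (Nat.find_min hex (m := s) (by omega))
  have hsn := le_card_of_not_isMultiplyPretransitive hs
  have hsy := lt_sq_of_isMultiplyPretransitive hA hmin (by omega) hy2 hlt
  have hsz : (s : ℝ) ≤ z ^ 8 := by
    have h1 : (s : ℝ) + 2 ≤ y ^ 2 := by exact_mod_cast hsy.le
    have h2 : (y : ℝ) ^ 2 ≤ (z ^ 4) ^ 2 := by gcongr
    nlinarith
  obtain ⟨m, hm⟩ : ∃ m, Fintype.card Ω = m + s := ⟨Fintype.card Ω - s, by omega⟩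
  obtain ⟨q, hq, hqm, hb, hk⟩ := exists_bounds_of_isMultiplyPretransitive s hm hG hmin hs
  set n := Fintype.card Ω with hn
  have hq0 : (0 : ℝ) < q := by exact_mod_cast hq
  have hm' : 0 < m := by omega
  have hm0 : (0 : ℝ) < m := by exact_mod_cast hm'
  have hmn : m ≤ n := by omega
  have hms : (n : ℝ) = m + s := by exact_mod_cast hm
  have hqm' : 2 * (q : ℝ) ≤ m := by exact_mod_cast hqm
  have hns := natCast_pow_le_rpow hc hn' le_rfl hlog s
  by_cases hqz : (q : ℝ) ≤ z ^ 16
  · refine (hb (c ^ (1 - 1 / (q : ℝ))) (Real.one_le_rpow hc1 ?_) fun r hr hrq ↦ ?_).trans ?_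
    · rw [sub_nonneg, div_le_one hq0]
      exact_mod_cast hq
    · exact (hB r hr (by omega)).mono (pow_pred_le_rpow_pow hc1 hr hrq)
    · have h1 := natCast_pow_le_rpow hc hm' hmn hlog (Nat.log 2 m + 2)
      have hl : (Nat.log 2 m : ℝ) ≤ 2 * z := by
        have hl2 := Real.log_two_gt_d9
        have := Real.natLog_le_logb m 2
        rw [Real.logb, Nat.cast_ofNat, le_div_iff₀ (by linarith)] at this
        have h5 : Real.log m ≤ z := (Real.log_le_log hm0 (by exact_mod_cast hmn)).trans hlog
        nlinarith [(Nat.cast_nonneg (Nat.log 2 m) : (0 : ℝ) ≤ _)]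
      rw [rpow_pow_eq hc0]
      calc (n : ℝ) ^ s * ((m : ℝ) ^ (Nat.log 2 m + 2) * c ^ ((m : ℝ) - m / q))
          ≤ c ^ (z * s) * (c ^ (z * (Nat.log 2 m + 2 : ℕ)) * c ^ ((m : ℝ) - m / q)) := by
            gcongr
        _ = c ^ (z * s + (z * (Nat.log 2 m + 2 : ℕ) + (m - m / q))) := by
          rw [← Real.rpow_add hc0, ← Real.rpow_add hc0]
        _ ≤ c ^ (n - 1) := by
          refine rpow_le_pow_pred hc hn' ?_
          have h3 : z ^ 16 / 2 ≤ m / q := by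
            rw [le_div_iff₀ hq0]
            calc z ^ 16 / 2 * q ≤ z ^ 16 / 2 * z ^ 16 := by gcongr
              _ = (n : ℝ) / 2 := by rw [← hzn]; ring
              _ ≤ (m : ℝ) := by linarith
          have h4 : z ^ 9 * 100 ^ 7 ≤ z ^ 16 := by
            rw [show z ^ 16 = z ^ 9 * z ^ 7 by ring]; gcongr
          have h6 : z ^ 2 * 100 ^ 7 ≤ z ^ 9 := by
            rw [show z ^ 9 = z ^ 2 * z ^ 7 by ring]; gcongr
          have h7 : z * s ≤ z * z ^ 8 := by gcongr
          have h8 : z * Nat.log 2 m ≤ z * (2 * z) := by gcongr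
          push_cast
          nlinarith
  · push Not at hqz
    obtain ⟨k, hkz, hkr⟩ := exists_pow_mul_sq_lt_one hz hzn hlog
    have h1 : (Nat.card G : ℝ) ≤ (n : ℝ) ^ s * (m : ℝ) ^ (2 * k) := by
      have hr1 : (q : ℝ) / (2 * m) ≤ 1 := by
        rw [div_le_one (by positivity)]
        linarith
      refine mod_cast hk k (lt_of_le_of_lt ?_ (hkr ((q : ℝ) / (2 * m)) ?_ hr1))
      · have : 0 ≤ 1 - (q : ℝ) / (2 * m) := by linarith
        gcongr
      · have : (m : ℝ) ≤ z ^ 32 := by rw [hzn]; exact_mod_cast hmn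
        rw [div_le_div_iff₀ (by positivity) (by positivity)]
        calc 1 * (2 * (m : ℝ)) ≤ 1 * (2 * z ^ 32) := by gcongr
          _ = z ^ 16 * (2 * z ^ 16) := by ring
          _ ≤ q * (2 * z ^ 16) := by gcongr
    calc (Nat.card G : ℝ) ≤ (n : ℝ) ^ s * (m : ℝ) ^ (2 * k) := h1
      _ ≤ c ^ (z * s) * c ^ (z * (2 * k : ℕ)) := by
        gcongr
        exact natCast_pow_le_rpow hc hm' hmn hlog _
      _ = c ^ (z * s + z * (2 * k : ℕ)) := (Real.rpow_add hc0 _ _).symm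
      _ ≤ c ^ (n - 1) := by
        refine rpow_le_pow_pred hc hn' ?_
        have h3 : z ^ 18 * 100 ^ 14 ≤ z ^ 32 := by
          rw [show z ^ 32 = z ^ 18 * z ^ 14 by ring]; gcongr
        have h4 : z * 100 ^ 17 ≤ z ^ 18 := by
          rw [show z ^ 18 = z * z ^ 17 by ring]; gcongr
        have h5 : z ^ 9 * 100 ^ 9 ≤ z ^ 18 := by
          rw [show z ^ 18 = z ^ 9 * z ^ 9 by ring]; gcongr
        have h7 : z * s ≤ z * z ^ 8 := by gcongr
        have h8 : z * k ≤ z * (4 * z ^ 17 + 1) := by gcongr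
        rw [← hzn]
        push_cast
        nlinarith

end Primitive

section Induction

variable {d : ℕ} {G Ω : Type*} [Group G] [MulAction G Ω] [Finite G] [Fintype Ω]
  [FaithfulSMul G Ω] {c : ℝ}

theorem card_le_pow_of_not_isPretransitive (hG : InGamma d G) (h : ¬ IsPretransitive G Ω)
    (hc : 1 ≤ c)
    (hB : ∀ r, 0 < r → r < Fintype.card Ω → DegreeBound d r (c ^ (r - 1))) :
    (Nat.card G : ℝ) ≤ c ^ (Fintype.card Ω - 1) := by
  classical
  obtain ⟨a, b, hab⟩ : ∃ a b : Ω, ∀ g : G, g • a ≠ b := by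
    by_contra! h'
    exact h ⟨h'⟩
  set U : Finset Ω := (orbit G a).toFinset with hU
  have haU : a ∈ U := by simp [hU]
  have hbU : b ∈ Uᶜ := by simpa [hU, mem_orbit_iff] using hab
  have hsum := Finset.card_add_card_compl U
  have hU0 : 0 < U.card := Finset.card_pos.2 ⟨a, haU⟩
  have hUc0 : 0 < Uᶜ.card := Finset.card_pos.2 ⟨b, hbU⟩
  have hinv : ∀ (g : G) (x : Ω), g • x ∈ U ↔ x ∈ U := by
    intro g x
    simp only [hU, Set.mem_toFinset]
    exact ⟨fun h ↦ by simpa using mem_orbit_of_mem_orbit g⁻¹ h, mem_orbit_of_mem_orbit g⟩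
  have h1 := fixCard_le_mul_fixCard_union hG ∅ U (fun g _ x hx ↦ (hinv g x).2 hx)
    (hB _ hU0 (by omega))
  have h2 := fixCard_le_mul_fixCard_union hG U Uᶜ
    (fun g _ x hx ↦ by rw [Finset.mem_compl, hinv]; exact Finset.mem_compl.1 hx)
    (hB _ hUc0 (by omega))
  rw [fixCard_empty, Finset.empty_union] at h1
  rw [Finset.union_compl, fixCard_univ, Nat.cast_one, mul_one] at h2
  calc (Nat.card G : ℝ) ≤ c ^ (U.card - 1) * c ^ (Uᶜ.card - 1) := by
        refine h1.trans ?_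
        gcongr
    _ = c ^ (U.card - 1 + (Uᶜ.card - 1)) := (pow_add _ _ _).symm
    _ ≤ c ^ (Fintype.card Ω - 1) := pow_le_pow_right₀ hc (by omega)

theorem card_le_pow_of_isBlock [IsPretransitive G Ω] (hG : InGamma d G) {B : Set Ω}
    (hblock : IsBlock G B) (hnt : ¬ IsTrivialBlock B) (hc : 1 ≤ c)
    (hB : ∀ r, 0 < r → r < Fintype.card Ω → DegreeBound d r (c ^ (r - 1))) :
    (Nat.card G : ℝ) ≤ c ^ (Fintype.card Ω - 1) := by
  classical
  have hc0 : 0 < c := by linarith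
  rw [IsTrivialBlock, not_or, Set.not_subsingleton_iff] at hnt
  obtain ⟨hB2, hBu⟩ := hnt
  have hmul := hblock.ncard_block_mul_ncard_orbit_eq hB2.nonempty
  have hlt : B.ncard < Nat.card Ω := Set.ncard_lt_card hBu
  have h1m : 1 < B.ncard := (Set.one_lt_ncard (Set.toFinite B)).2 hB2
  rw [Nat.card_eq_fintype_card] at hmul hlt
  have : Fintype (orbit G B) := Fintype.ofFinite _
  have hb : Fintype.card (orbit G B) = (orbit G B).ncard := by
    rw [← Nat.card_coe_set_eq, Nat.card_eq_fintype_card]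
  rw [← hb] at hmul
  set n := Fintype.card Ω with hn
  set m := B.ncard with hm
  set b := Fintype.card (orbit G B) with hbdef
  have hb0 : 0 < b := Nat.pos_of_ne_zero fun h ↦ by simp [h] at hmul; omega
  have hbn : b < n := by nlinarith
  have hmb : b ≤ m * b := Nat.le_mul_of_pos_left b (by omega)
  have hker := (hB b hb0 hbn).card_le_mul_card_ker hG
  set K := (toPermHom G (orbit G B)).ker with hK
  have hKfix : ∀ (k : K) (g : G), k • (g • B) = g • B := by
    intro k g
    have := DFunLike.congr_fun (MonoidHom.mem_ker.1 k.2) ⟨g • B, mem_orbit B g⟩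
    exact congrArg Subtype.val this
  have hm0 : (0 : ℝ) < m := by exact_mod_cast (by omega : 0 < m)
  obtain ⟨F, -, hF, hcard⟩ := exists_isSmallClosed (q := m) (b := c ^ (1 - 1 / (m : ℝ)))
    (by positivity) (hG.subgroup K)
    (fun r hr hrm ↦ (hB r hr (by omega)).mono (pow_pred_le_rpow_pow hc hr hrm)) (∅ : Finset Ω)
  have hFu : F = Finset.univ := by
    refine Finset.eq_univ_of_forall fun x ↦ ?_
    obtain ⟨y, hy⟩ := hB2.nonempty
    obtain ⟨g, rfl⟩ := exists_smul_eq G y x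
    refine hF (g • B).toFinset ?_ ?_ (Set.mem_toFinset.2 (Set.smul_mem_smul_set hy))
    · rw [← Set.ncard_eq_toFinset_card', Set.ncard_smul_set]
    · intro k _ z hz
      rw [Set.mem_toFinset] at hz ⊢
      rw [← hKfix k g]
      exact Set.smul_mem_smul_set hz
  rw [hFu, fixCard_univ, fixCard_empty, Finset.card_empty, pow_zero, mul_one, Nat.cast_one,
    mul_one, Finset.card_univ, rpow_pow_eq hc0] at hcard
  have hexp : (Fintype.card Ω : ℝ) - Fintype.card Ω / m = (m * b - b : ℕ) := by
    rw [← hn, ← hmul]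
    push_cast [hmb]
    field_simp
  rw [hexp, Real.rpow_natCast] at hcard
  calc (Nat.card G : ℝ) ≤ c ^ (b - 1) * c ^ (m * b - b) := by
        refine hker.trans ?_
        gcongr
    _ = c ^ (b - 1 + (m * b - b)) := (pow_add _ _ _).symm
    _ = c ^ (n - 1) := by
      congr 1
      omega

end Induction

open scoped Nat in
/-- If `c ≥ e` is large enough that all small symmetric groups satisfy the bound `c ^ (m - 1)`,
then so do all permutation groups without sections isomorphic to a large alternating group. -/
theorem exists_forall_degreeBound : ∃ N : ℕ, ∀ d ≥ N, ∀ c : ℝ, Real.exp 1 ≤ c →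
    (∀ m < d, (m ! : ℝ) ≤ c ^ (m - 1)) → ∀ n, DegreeBound d n (c ^ (n - 1)) := by
  obtain ⟨N, hN⟩ := exists_pow_eq_and_log_le
  refine ⟨N, fun d hd c hc hfac n ↦ ?_⟩
  have hc1 : 1 ≤ c := (Real.one_le_exp zero_le_one).trans hc
  induction n using Nat.strong_induction_on with
  | _ n ih =>
  intro G hG
  by_cases hnd : n < d
  · refine le_trans ?_ (hfac n hnd)
    have := Subgroup.card_le_card_group G
    rw [Nat.card_perm, Nat.card_fin] at this
    exact_mod_cast this
  have hB : ∀ r, 0 < r → r < Fintype.card (Fin n) → DegreeBound d r (c ^ (r - 1)) :=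
    fun r _ hr ↦ ih r (by simpa using hr)
  have key : (Nat.card G : ℝ) ≤ c ^ (Fintype.card (Fin n) - 1) := by
    by_cases ht : IsPretransitive G (Fin n)
    swap
    · exact card_le_pow_of_not_isPretransitive hG ht hc1 hB
    by_cases hp : ∀ B : Set (Fin n), IsBlock G B → IsTrivialBlock B
    swap
    · push Not at hp
      obtain ⟨B, hB1, hB2⟩ := hp
      exact card_le_pow_of_isBlock hG hB1 hB2 hc1 hB
    have hprim : IsPreprimitive G (Fin n) := { isTrivialBlock_of_isBlock := hp _ }
    obtain ⟨z, hz, hzn, hlog⟩ := hN n (by omega)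
    have hA := hG.not_alternatingGroup_le (by simpa using hnd)
    have hcard : Fintype.card (Fin n) = n := Fintype.card_fin n
    by_cases h2 : IsMultiplyPretransitive G (Fin n) 2
    · exact card_le_pow_of_two_transitive hc hz (by rwa [hcard]) (by rwa [hcard]) hG hA hB h2
    · exact card_le_pow_of_not_two_transitive hc hz (by rwa [hcard]) (by rwa [hcard]) hG hB h2
  simpa using key

section Final

open scoped Nat

theorem factorial_succ_le_pow (k : ℕ) : (k + 1)! ≤ (k + 1) ^ k := by
  induction k with
  | zero => simp
  | succ k ih =>
    rw [Nat.factorial_succ, pow_succ']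
    gcongr
    exact ih.trans (Nat.pow_le_pow_left (by omega) k)

theorem factorial_succ_mul_exp_le (k : ℕ) :
    ((k + 1)! : ℝ) * Real.exp 1 ^ k ≤ ((k + 1 : ℕ) : ℝ) ^ (k + 2) := by
  induction k with
  | zero => simp
  | succ k ih =>
    have h1 : ((k + 1 : ℕ) : ℝ) / (k + 2 : ℕ) ≤ Real.exp (-1 / (k + 2 : ℕ)) := by
      have := Real.add_one_le_exp (-1 / ((k + 2 : ℕ) : ℝ))
      refine le_trans (le_of_eq ?_) this
      push_cast
      field_simp
      ring
    have h2 : (((k + 1 : ℕ) : ℝ) / (k + 2 : ℕ)) ^ (k + 2) * Real.exp 1 ≤ 1 := by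
      calc (((k + 1 : ℕ) : ℝ) / (k + 2 : ℕ)) ^ (k + 2) * Real.exp 1
          ≤ Real.exp (-1 / (k + 2 : ℕ)) ^ (k + 2) * Real.exp 1 := by gcongr
        _ = 1 := by
          rw [← Real.exp_nat_mul, ← Real.exp_add, mul_div_cancel₀ _ (by positivity)]
          simp
    rw [div_pow, div_mul_eq_mul_div, div_le_one (by positivity)] at h2
    rw [Nat.factorial_succ, pow_succ]
    calc (((k + 1 + 1) * (k + 1)! : ℕ) : ℝ) * (Real.exp 1 ^ k * Real.exp 1)
        = (k + 2 : ℕ) * (((k + 1)! : ℝ) * Real.exp 1 ^ k * Real.exp 1) := by push_cast; ring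
      _ ≤ (k + 2 : ℕ) * (((k + 1 : ℕ) : ℝ) ^ (k + 2) * Real.exp 1) := by gcongr
      _ ≤ (k + 2 : ℕ) * ((k + 2 : ℕ) : ℝ) ^ (k + 2) := by gcongr
      _ = ((k + 1 + 1 : ℕ) : ℝ) ^ (k + 1 + 2) := by ring

theorem exists_factorial_le_pow {ε : ℝ} (hε : 1 < ε) : ∃ N : ℕ, ∀ d ≥ N,
    ∀ m < d, (m ! : ℝ) ≤ (ε * d / Real.exp 1) ^ (m - 1) := by
  have hlim := tendsto_pow_const_div_const_pow_of_one_lt 2 hε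
  have hε0 : 0 < ε := by linarith
  obtain ⟨M, hM⟩ := Filter.eventually_atTop.1
    (hlim.eventually_le_const (by positivity : (0 : ℝ) < 1 / ε))
  have he := Real.exp_pos 1
  obtain ⟨N, hN⟩ := exists_nat_ge (M * Real.exp 1)
  refine ⟨N, fun d hd m hm ↦ ?_⟩
  obtain _ | k := m
  · simp
  rw [Nat.add_sub_cancel]
  by_cases hk : k + 1 < M
  · calc ((k + 1)! : ℝ) ≤ ((k + 1 : ℕ) : ℝ) ^ k := by exact_mod_cast factorial_succ_le_pow k
      _ ≤ (ε * d / Real.exp 1) ^ k := by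
        gcongr
        rw [le_div_iff₀ he]
        have h1 : ((k + 1 : ℕ) : ℝ) ≤ M := by exact_mod_cast hk.le
        have h2 : (N : ℝ) ≤ d := by exact_mod_cast hd
        calc ((k + 1 : ℕ) : ℝ) * Real.exp 1 ≤ M * Real.exp 1 := by gcongr
          _ ≤ 1 * d := by linarith
          _ ≤ ε * d := by gcongr
  · have h1 := hM (k + 1) (by omega)
    rw [div_le_div_iff₀ (by positivity) hε0, pow_succ ε k, one_mul, mul_le_mul_iff_left₀ hε0] at h1
    rw [div_pow, mul_pow, le_div_iff₀ (by positivity)]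
    calc ((k + 1)! : ℝ) * Real.exp 1 ^ k ≤ ((k + 1 : ℕ) : ℝ) ^ (k + 2) :=
          factorial_succ_mul_exp_le k
      _ = ((k + 1 : ℕ) : ℝ) ^ 2 * ((k + 1 : ℕ) : ℝ) ^ k := by ring
      _ ≤ ε ^ k * (d : ℝ) ^ k := by gcongr

theorem exists_forall_degreeBound_of_one_lt {ε : ℝ} (hε : 1 < ε) : ∃ N : ℕ, ∀ d ≥ N, ∀ n,
    DegreeBound d n ((ε * d / Real.exp 1) ^ (n - 1)) := by
  obtain ⟨N₁, h₁⟩ := exists_forall_degreeBound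
  obtain ⟨N₂, h₂⟩ := exists_factorial_le_pow hε
  obtain ⟨N₃, h₃⟩ := exists_nat_ge (Real.exp 1 * Real.exp 1)
  refine ⟨max N₁ (max N₂ N₃), fun d hd ↦ h₁ d (by omega) _ ?_ (h₂ d (by omega))⟩
  rw [le_div_iff₀ (Real.exp_pos 1)]
  have : (N₃ : ℝ) ≤ d := by exact_mod_cast (by omega : N₃ ≤ d)
  calc Real.exp 1 * Real.exp 1 ≤ 1 * d := by linarith
    _ ≤ ε * d := by gcongr

end Final

/-- **Corollary 3(ii).** For every `δ > 0` there is `N₂(δ)` such that for all `d ≥ N₂(δ)`: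
if `G ≤ Sym(Ω)` has degree `n` and every point stabilizer `G_α` lies in `Γ_d`, then
`|G| ≤ ((1+δ)d/e)^{n-1}`. -/
theorem order_le_of_point_stabilizers_in_gamma (δ : ℝ) (hδ : 0 < δ) :
    ∃ N : ℕ, ∀ d : ℕ, N ≤ d → ∀ (Ω : Type) [Fintype Ω],
      ∀ G : Subgroup (Equiv.Perm Ω),
        (∀ α : Ω, InGamma d ↥(MulAction.stabilizer (↥G) α)) →
        (Nat.card ↥G : ℝ) ≤ ((1 + δ) * d / Real.exp 1) ^ (Fintype.card Ω - 1) := by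
  have he := Real.exp_pos 1
  obtain ⟨N₁, h₁⟩ := exists_forall_degreeBound_of_one_lt (by linarith : 1 < 1 + δ / 2)
  set ρ : ℝ := (1 + δ) / (1 + δ / 2) with hρ
  have hρ1 : 1 < ρ := by
    rw [hρ, one_lt_div (by positivity)]
    linarith
  obtain ⟨N₂, h₂⟩ := exists_nat_ge ((2 + 1 / (ρ - 1)) * Real.exp 1)
  refine ⟨max N₁ N₂, fun d hd Ω _ G hG ↦ ?_⟩
  rcases Nat.lt_or_ge (Fintype.card Ω) 2 with hΩ | hΩ
  · have : Subsingleton Ω := Fintype.card_le_one_iff_subsingleton.1 (by omega)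
    have h0 : Fintype.card Ω - 1 = 0 := by omega
    simp [h0]
  obtain ⟨k, hk⟩ : ∃ k, Fintype.card Ω = k + 2 := ⟨Fintype.card Ω - 2, by omega⟩
  obtain ⟨a⟩ : Nonempty Ω := Fintype.card_pos_iff.1 (by omega)
  have : Fintype (SubMulAction.ofStabilizer G a) := Fintype.ofFinite _
  have hcard : Fintype.card (SubMulAction.ofStabilizer G a) = k + 1 := by
    rw [← Nat.card_eq_fintype_card, SubMulAction.nat_card_ofStabilizer_eq,
      Nat.card_eq_fintype_card, hk]
    omega
  have hst := (h₁ d (by omega) _).card_le (Ω := SubMulAction.ofStabilizer G a) (hG a)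
  rw [hcard, Nat.add_sub_cancel] at hst
  have hd2 : (N₂ : ℝ) ≤ d := by exact_mod_cast (by omega : N₂ ≤ d)
  have hC : 2 + 1 / (ρ - 1) ≤ (1 + δ) * d / Real.exp 1 := by
    rw [le_div_iff₀ he]
    calc (2 + 1 / (ρ - 1)) * Real.exp 1 ≤ 1 * d := by linarith
      _ ≤ (1 + δ) * d := by gcongr; linarith
  have hk2 : (k : ℝ) + 2 ≤ ρ ^ k * (2 + 1 / (ρ - 1)) := by
    have hb := one_add_mul_le_pow (by linarith : (-2 : ℝ) ≤ ρ - 1) k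
    rw [add_sub_cancel] at hb
    have hρ0 : 0 < ρ - 1 := by linarith
    calc (k : ℝ) + 2 ≤ (1 + k * (ρ - 1)) * (2 + 1 / (ρ - 1)) := by
          have : (1 + k * (ρ - 1)) * (2 + 1 / (ρ - 1)) =
            k + 2 + (2 * (k * (ρ - 1)) + 1 / (ρ - 1)) := by field_simp; ring
          rw [this]
          have : 0 ≤ 2 * (k * (ρ - 1)) + 1 / (ρ - 1) := by positivity
          linarith
      _ ≤ ρ ^ k * (2 + 1 / (ρ - 1)) := by gcongr
  rw [hk, show k + 2 - 1 = k + 1 by omega]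
  calc (Nat.card G : ℝ) ≤ Fintype.card Ω * Nat.card (stabilizer G a) := by
        exact_mod_cast card_le_card_mul_card_stabilizer (G := G) a
    _ ≤ (k + 2) * ((1 + δ / 2) * d / Real.exp 1) ^ k := by
      rw [hk]
      push_cast
      gcongr
    _ ≤ (ρ ^ k * ((1 + δ) * d / Real.exp 1)) * ((1 + δ / 2) * d / Real.exp 1) ^ k := by
      gcongr
      exact hk2.trans (by gcongr)
    _ = (ρ * ((1 + δ / 2) * d / Real.exp 1)) ^ k * ((1 + δ) * d / Real.exp 1) := by
      rw [mul_pow]; ring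
    _ = ((1 + δ) * d / Real.exp 1) ^ (k + 1) := by
      rw [pow_succ, hρ]
      congr 2
      field_simp
end

section
/- Let R ≤ Sym(Δ) be a solvable permutation group on a finite set Δ. Then the distinguishing number of R is at most 5; that is, there exists a colouring f : Δ → {1,2,3,4,5} such that the only element of R preserving f is the identity. -/
open scoped Pointwise

/-- A family in a group is irredundant if no member lies in the subgroup generated by the others. -/
def IrredundantFamily {A ι : Type*} [Group A] (e : ι → A) : Prop :=
  ∀ i, e i ∉ Subgroup.closure (e '' {i}ᶜ)

namespace IrredundantFamily

variable {A ι : Type*} [Group A] {e : ι → A}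

theorem mem_closure {i j : ι} (h : j ≠ i) : e j ∈ Subgroup.closure (e '' {i}ᶜ) :=
  Subgroup.subset_closure ⟨j, h, rfl⟩

theorem injective (he : IrredundantFamily e) : Function.Injective e := by
  intro i j hij
  by_contra hne
  exact he i (hij ▸ mem_closure (Ne.symm hne))

theorem ne_one (he : IrredundantFamily e) (i : ι) : e i ≠ 1 := fun h =>
  he i (h ▸ one_mem _)

theorem mul_ne_one (he : IrredundantFamily e) {i j : ι} (hij : i ≠ j) : e i * e j ≠ 1 := by
  intro h
  refine he i ?_
  rw [eq_inv_of_mul_eq_one_left h]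
  exact inv_mem (mem_closure hij.symm)

theorem mul_ne (he : IrredundantFamily e) {i j : ι} (hij : i ≠ j) (k : ι) : e i * e j ≠ e k := by
  intro h
  by_cases hik : k = i
  · subst hik
    exact he.ne_one j (mul_eq_left.mp h)
  · refine he i ?_
    rw [eq_mul_inv_of_mul_eq h]
    exact mul_mem (mem_closure hik) (inv_mem (mem_closure hij.symm))

theorem left_eq_or_eq (he : IrredundantFamily e) {i k a b : ι} (hik : i ≠ k)
    (h : e i * e k = e a * e b) : i = a ∨ i = b := by
  by_contra! hne
  refine he i ?_
  rw [eq_mul_inv_of_mul_eq h]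
  exact mul_mem (mul_mem (mem_closure hne.1.symm) (mem_closure hne.2.symm))
    (inv_mem (mem_closure hik.symm))

theorem right_eq_or_eq (he : IrredundantFamily e) {i k a b : ι} (hik : i ≠ k)
    (h : e i * e k = e a * e b) : k = a ∨ k = b := by
  by_contra! hne
  refine he k ?_
  rw [eq_inv_mul_of_mul_eq h]
  exact mul_mem (inv_mem (mem_closure hik))
    (mul_mem (mem_closure hne.1.symm) (mem_closure hne.2.symm))

end IrredundantFamily

theorem exists_irredundantFamily_closure_eq_top (A : Type*) [Group A] [Finite A] :
    ∃ (d : ℕ) (e : Fin d → A), IrredundantFamily e ∧ Subgroup.closure (Set.range e) = ⊤ := by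
  classical
  have hex : ∃ d : ℕ, ∃ e : Fin d → A, Subgroup.closure (Set.range e) = ⊤ := by
    refine ⟨Nat.card A, (Finite.equivFin A).symm, ?_⟩
    rw [(Finite.equivFin A).symm.surjective.range_eq, Subgroup.closure_univ]
  obtain ⟨e, he⟩ := Nat.find_spec hex
  refine ⟨_, e, fun i hi => ?_, he⟩
  have hlt : Nat.find hex - 1 < Nat.find hex := by have := i.pos; omega
  refine Nat.find_min hex hlt ?_
  have hcard : Fintype.card {j : Fin (Nat.find hex) // j ≠ i} = Nat.find hex - 1 := by
    simp
  refine ⟨fun j => e ((Fintype.equivFinOfCardEq hcard).symm j), ?_⟩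
  have hr : Set.range (fun j => e ((Fintype.equivFinOfCardEq hcard).symm j)) = e '' {i}ᶜ := by
    ext x
    constructor
    · rintro ⟨j, rfl⟩
      exact ⟨_, ((Fintype.equivFinOfCardEq hcard).symm j).2, rfl⟩
    · rintro ⟨j, hj, rfl⟩
      exact ⟨Fintype.equivFinOfCardEq hcard ⟨j, hj⟩, by simp⟩
  rw [hr]
  refine top_unique (he.ge.trans ((Subgroup.closure_le _).mpr ?_))
  rintro _ ⟨j, rfl⟩
  by_cases hj : j = i
  · exact hj ▸ hi
  · exact IrredundantFamily.mem_closure hj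

open Classical in
/-- The colouring of a group that singles out the identity, the first member of a family, the
other members, and the products of consecutive members. -/
noncomputable def pathColoring {A : Type*} [Group A] {d : ℕ} (e : Fin d → A) (x : A) : Fin 5 :=
  if x = 1 then 0
  else if ∃ i : Fin d, i.val = 0 ∧ x = e i then 1
  else if ∃ i : Fin d, x = e i then 2
  else if ∃ i j : Fin d, i.val + 1 = j.val ∧ x = e i * e j then 3
  else 4

section pathColoring

variable {A : Type*} [Group A] {d : ℕ} {e : Fin d → A}

theorem pathColoring_eq_zero_iff {x : A} : pathColoring e x = 0 ↔ x = 1 := by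
  unfold pathColoring
  split_ifs <;> simp_all

theorem pathColoring_of_val_eq_zero (he : IrredundantFamily e) {i : Fin d} (hi : i.val = 0) :
    pathColoring e (e i) = 1 := by
  unfold pathColoring
  rw [if_neg (he.ne_one i), if_pos ⟨i, hi, rfl⟩]

theorem pathColoring_of_val_ne_zero (he : IrredundantFamily e) {i : Fin d} (hi : i.val ≠ 0) :
    pathColoring e (e i) = 2 := by
  unfold pathColoring
  rw [if_neg (he.ne_one i), if_neg, if_pos ⟨i, rfl⟩]
  rintro ⟨j, hj, hij⟩
  exact hi (he.injective hij ▸ hj)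

theorem pathColoring_mul (he : IrredundantFamily e) {i j : Fin d} (hij : i.val + 1 = j.val) :
    pathColoring e (e i * e j) = 3 := by
  have hne : i ≠ j := by rintro rfl; omega
  unfold pathColoring
  rw [if_neg (he.mul_ne_one hne), if_neg, if_neg, if_pos ⟨i, j, hij, rfl⟩]
  · rintro ⟨k, hk⟩
    exact he.mul_ne hne k hk
  · rintro ⟨k, -, hk⟩
    exact he.mul_ne hne k hk

theorem exists_of_pathColoring_eq_one {x : A} (h : pathColoring e x = 1) :
    ∃ i : Fin d, i.val = 0 ∧ x = e i := by
  unfold pathColoring at h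
  split_ifs at h <;> simp_all

theorem exists_of_pathColoring_eq_two {x : A} (h : pathColoring e x = 2) :
    ∃ i : Fin d, x = e i := by
  unfold pathColoring at h
  split_ifs at h <;> first | assumption | simp_all

theorem exists_of_pathColoring_eq_three {x : A} (h : pathColoring e x = 3) :
    ∃ i j : Fin d, i.val + 1 = j.val ∧ x = e i * e j := by
  unfold pathColoring at h
  split_ifs at h <;> first | assumption | simp_all

theorem apply_eq_of_pathColoring_comp_eq (he : IrredundantFamily e) {σ : A →* A}
    (hσ : Function.Injective σ) (h : ∀ x, pathColoring e (σ x) = pathColoring e x) (i : Fin d) :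
    σ (e i) = e i := by
  obtain ⟨n, hn⟩ := i
  induction n using Nat.strong_induction_on with
  | _ n ih =>
  rcases n with _ | n
  · obtain ⟨j, hj, hj'⟩ := exists_of_pathColoring_eq_one
      ((h (e ⟨0, hn⟩)).trans (pathColoring_of_val_eq_zero he rfl))
    rw [hj']
    congr 1
    exact Fin.ext hj
  · obtain ⟨k, hk⟩ := exists_of_pathColoring_eq_two
      ((h (e ⟨n + 1, hn⟩)).trans (pathColoring_of_val_ne_zero he (Nat.succ_ne_zero n)))
    have fixed_ne : ∀ m, (hm : m < n + 1) → k ≠ ⟨m, hm.trans hn⟩ := by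
      rintro m hm rfl
      have h1 := he.injective (hσ (hk.trans (ih m hm (hm.trans hn)).symm))
      have h2 := congrArg Fin.val h1
      simp only at h2
      omega
    have hn' : n < d := by omega
    obtain ⟨a, b, hab, hmul⟩ := exists_of_pathColoring_eq_three
      ((h (e ⟨n, hn'⟩ * e ⟨n + 1, hn⟩)).trans (pathColoring_mul he rfl))
    rw [map_mul, ih n (Nat.lt_succ_self n) hn', hk] at hmul
    have hnk : (⟨n, hn'⟩ : Fin d) ≠ k := (fixed_ne n (Nat.lt_succ_self n)).symm
    have h1 := he.left_eq_or_eq hnk hmul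
    have h2 := he.right_eq_or_eq hnk hmul
    have h3 : ∀ m, m < n + 1 → k.val ≠ m := fun m hm hkm => fixed_ne m hm (Fin.ext hkm)
    have h4 := h3 k.val
    rw [hk]
    congr 1
    simp only [Fin.ext_iff] at h1 h2 ⊢
    omega

/-- An injective self-map that shifts all colours of a path colouring by the same amount fixes all
colours. -/
theorem shift_eq_zero_of_pathColoring (he : IrredundantFamily e)
    {φ : A → A} (hφ : Function.Injective φ) {t : Fin 5}
    (h : ∀ x, pathColoring e (φ x) = pathColoring e x + t) : t = 0 := by
  by_contra ht
  have iter : ∀ (k : ℕ) x, pathColoring e (φ^[k] x) = pathColoring e x + k • t := by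
    intro k
    induction k with
    | zero => simp
    | succ k ih => intro x; rw [Function.iterate_succ_apply', h, ih, succ_nsmul, add_assoc]
  have solve : ∀ t : Fin 5, t ≠ 0 → ∀ v w : Fin 5, ∃ k : Fin 5, v + k.val • t = w := by decide
  have inj : Function.Injective (pathColoring e) := by
    intro x y hxy
    obtain ⟨k, hk⟩ := solve t ht (pathColoring e x) 0
    refine hφ.iterate k.val ?_
    rw [pathColoring_eq_zero_iff.mp ((iter k.val x).trans hk),
      pathColoring_eq_zero_iff.mp ((iter k.val y).trans (hxy ▸ hk))]
  have surj : Function.Surjective (pathColoring e) := by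
    intro w
    obtain ⟨k, hk⟩ := solve t ht (pathColoring e 1) w
    exact ⟨_, (iter k.val 1).trans hk⟩
  have hcard : Nat.card A = 5 := by
    rw [Nat.card_congr (Equiv.ofBijective _ ⟨inj, surj⟩), Nat.card_fin]
  have : Fact (Nat.card A).Prime := ⟨by rw [hcard]; norm_num⟩
  obtain ⟨x, hx⟩ := surj 3
  obtain ⟨i, j, hij, -⟩ := exists_of_pathColoring_eq_three hx
  have hne : i ≠ j := by rintro rfl; omega
  rcases Subgroup.eq_bot_or_eq_top_of_prime_card (Subgroup.closure (e '' {j}ᶜ)) with hb | hb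
  · have := IrredundantFamily.mem_closure (e := e) hne
    rw [hb, Subgroup.mem_bot] at this
    exact he.ne_one i this
  · exact he j (hb ▸ Subgroup.mem_top _)

end pathColoring

/-- The holomorph of a finite group has five inequivalent distinguishing 5-colourings. -/
theorem exists_colorings_holomorph (A : Type*) [Group A] [Finite A] :
    ∃ F : Fin 5 → A → Fin 5, ∀ (i j : Fin 5) (σ : A →* A) (a : A), Function.Injective σ →
      (∀ x, F i (a * σ x) = F j x) → i = j ∧ ∀ x, a * σ x = x := by
  obtain ⟨d, e, he, hgen⟩ := exists_irredundantFamily_closure_eq_top A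
  refine ⟨fun i x => pathColoring e x + i, fun i j σ a hσ h => ?_⟩
  have hshift : ∀ x, pathColoring e (a * σ x) = pathColoring e x + (j - i) := fun x => by
    have hx : pathColoring e (a * σ x) + i = pathColoring e x + j := h x
    rw [← add_sub_assoc, ← hx, add_sub_cancel_right]
  have ht := shift_eq_zero_of_pathColoring he ((mul_right_injective a).comp hσ) hshift
  simp only [ht, add_zero] at hshift
  have ha : a = 1 := by
    have h1 := hshift 1
    rwa [map_one, mul_one, pathColoring_eq_zero_iff.mpr rfl, pathColoring_eq_zero_iff] at h1
  subst ha
  simp only [one_mul] at hshift ⊢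
  refine ⟨(sub_eq_zero.mp ht).symm, fun x => ?_⟩
  have heq : σ = MonoidHom.id A := by
    refine MonoidHom.eq_of_eqOn_dense hgen ?_
    rintro _ ⟨i, rfl⟩
    exact apply_eq_of_pathColoring_comp_eq he hσ hshift i
  rw [heq, MonoidHom.id_apply]

/-- Five colourings of `S` by five colours which are distinguishing and pairwise inequivalent under
the setwise stabilizer of `S` (elements outside of `S` are irrelevant). -/
def HasFiveColorings (G : Type*) {Ω : Type*} [Group G] [MulAction G Ω] (S : Set Ω) : Prop :=
  ∃ F : Fin 5 → Ω → Fin 5, ∀ (i j : Fin 5) (g : G), (∀ x, g • x ∈ S ↔ x ∈ S) →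
    (∀ x ∈ S, F i (g • x) = F j x) → i = j ∧ ∀ x ∈ S, g • x = x

theorem hasFiveColorings_orbit {G Ω : Type*} [Group G] [Finite G] [MulAction G Ω] (N : Subgroup G)
    [N.Normal] (hN : ∀ m n : N, ∀ x : Ω, (m * n) • x = (n * m) • x) (p : Ω) :
    HasFiveColorings G (MulAction.orbit N p) := by
  classical
  have hK : (MulAction.stabilizer N p).Normal := by
    refine ⟨fun n hn g => ?_⟩
    rw [MulAction.mem_stabilizer_iff] at hn ⊢
    rw [hN, inv_mul_cancel_left, hn]
  set K := MulAction.stabilizer N p with hKdef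
  have hq : ∀ m n : N, (m : N ⧸ K) = n ↔ m • p = n • p := by
    intro m n
    rw [QuotientGroup.eq, hKdef, MulAction.mem_stabilizer_iff, mul_smul, inv_smul_eq_iff, eq_comm]
  obtain ⟨F, hF⟩ := exists_colorings_holomorph (N ⧸ K)
  have hrep : ∀ x, ∃ n : N, x ∈ MulAction.orbit N p → n • p = x := by
    intro x
    by_cases hx : x ∈ MulAction.orbit N p
    · obtain ⟨n, hn⟩ := hx
      exact ⟨n, fun _ => hn⟩
    · exact ⟨1, fun h => absurd h hx⟩
  choose r hr using hrep
  have hr' : ∀ n : N, ((r (n • p) : N) : N ⧸ K) = n := fun n =>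
    (hq _ _).mpr (hr _ ⟨n, rfl⟩)
  refine ⟨fun i x => F i (r x : N), fun i j g hg h => ?_⟩
  obtain ⟨a, ha⟩ := (hg p).mpr (MulAction.mem_orbit_self p)
  have ha : (a : G) • p = g • p := ha
  set b : G := (a : G)⁻¹ * g with hb
  have hbp : b • p = p := by rw [hb, mul_smul, ← ha, inv_smul_smul]
  have hconj : ∀ n : N, (MulAut.conjNormal b n) • p = b • n • p := by
    intro n
    change ((MulAut.conjNormal b n : N) : G) • p = b • (n : G) • p
    rw [MulAut.conjNormal_apply, mul_smul, mul_smul, inv_smul_eq_iff.mpr hbp.symm]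
  let τ : N →* N ⧸ K := (QuotientGroup.mk' K).comp (MulAut.conjNormal b).toMonoidHom
  have hτ : ∀ m n : N, τ m = τ n ↔ m • p = n • p := by
    intro m n
    change ((MulAut.conjNormal b m : N) : N ⧸ K) = (MulAut.conjNormal b n : N) ↔ _
    rw [hq, hconj, hconj, smul_left_cancel_iff]
  let σ : N ⧸ K →* N ⧸ K := QuotientGroup.lift K τ fun n hn => by
    rw [MonoidHom.mem_ker, ← map_one τ, hτ, one_smul]
    exact hn
  have hσ : ∀ n : N, σ n = τ n := fun n => rfl
  have hσinj : Function.Injective σ := by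
    intro x y
    induction x using QuotientGroup.induction_on with | _ m
    induction y using QuotientGroup.induction_on with | _ n
    rw [hσ, hσ, hτ, hq]
    exact id
  have hact : ∀ n : N, g • n • p = (a * MulAut.conjNormal b n) • p := by
    intro n
    rw [mul_smul, hconj]
    change g • n • p = (a : G) • b • n • p
    rw [hb, mul_smul, smul_inv_smul]
  have key := hF i j σ a hσinj (by
    intro x
    induction x using QuotientGroup.induction_on with | _ n
    have := h (n • p) ⟨n, rfl⟩
    beta_reduce at this
    rw [hact, hr', hr'] at this
    exact this)
  refine ⟨key.1, ?_⟩
  rintro _ ⟨n, rfl⟩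
  change g • n • p = n • p
  rw [hact, ← hq]
  exact key.2 n

theorem hasFiveColorings_of_fibers {G Δ Ω : Type*} [Group G] [MulAction G Δ] [MulAction G Ω]
    {π : Δ → Ω} (hπ : ∀ (g : G) x, π (g • x) = g • π x)
    (hΩ : HasFiveColorings G (Set.univ : Set Ω)) (hfib : ∀ ω, HasFiveColorings G (π ⁻¹' {ω})) :
    HasFiveColorings G (Set.univ : Set Δ) := by
  obtain ⟨H, hH⟩ := hΩ
  choose F hF using hfib
  let r : Ω → Ω := fun ω => (Quotient.mk (MulAction.orbitRel G Ω) ω).out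
  have hr : ∀ (g : G) ω, r (g • ω) = r ω := fun g ω =>
    congrArg Quotient.out (Quotient.sound (s := MulAction.orbitRel G Ω) ⟨g, rfl⟩)
  have hrep : ∀ ω, ∃ t : G, t • r ω = ω := fun ω => by
    have h : (MulAction.orbitRel G Ω) (r ω) ω :=
      Quotient.exact (Quotient.out_eq (Quotient.mk (MulAction.orbitRel G Ω) ω))
    exact (MulAction.orbitRel G Ω).symm h
  choose t ht using hrep
  refine ⟨fun i x => F (r (π x)) (H i (π x)) ((t (π x))⁻¹ • x), fun i j g _ h => ?_⟩
  have hloc : ∀ ω, H i (g • ω) = H j ω ∧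
      ∀ x ∈ π ⁻¹' {r ω}, ((t (g • ω))⁻¹ * g * t ω) • x = x := by
    intro ω
    have hfix : ((t (g • ω))⁻¹ * g * t ω) • r ω = r ω := by
      rw [mul_smul, mul_smul, ht, inv_smul_eq_iff, ← hr g ω, ht]
    refine hF (r ω) _ _ _ (fun x => ?_) fun x hx => ?_
    · simp only [Set.mem_preimage, Set.mem_singleton_iff, hπ]
      conv_lhs => rw [← hfix, smul_left_cancel_iff]
    · have hx : π x = r ω := hx
      have := h (t ω • x) (Set.mem_univ _)
      simp only [hπ, hx, ht, hr, inv_smul_smul] at this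
      rw [mul_smul, mul_smul]
      exact this
  obtain ⟨hij, hfix⟩ := hH i j g (fun _ => by simp) (fun ω _ => (hloc ω).1)
  refine ⟨hij, fun x _ => ?_⟩
  have h1 := (hloc (π x)).2 ((t (π x))⁻¹ • x) (by
    simp only [Set.mem_preimage, Set.mem_singleton_iff, hπ, inv_smul_eq_iff, ht])
  rw [hfix _ (Set.mem_univ _), mul_smul, mul_smul, smul_inv_smul, smul_left_cancel_iff] at h1
  exact h1

/-- The action of a group on the orbits of a normal subgroup. -/
@[reducible]
def orbitsMulAction {G : Type*} (Ω : Type*) [Group G] [MulAction G Ω] (N : Subgroup G)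
    [hN : N.Normal] : MulAction G (MulAction.orbitRel.Quotient N Ω) where
  smul g := Quotient.map (g • ·) (by
    rintro x y ⟨n, rfl⟩
    refine ⟨⟨g * n * g⁻¹, hN.conj_mem n n.2 g⟩, ?_⟩
    change (g * (n : G) * g⁻¹) • g • y = g • (n : G) • y
    rw [mul_smul, mul_smul, inv_smul_smul])
  one_smul x := by
    induction x using Quotient.inductionOn with | _ x
    exact congrArg _ (one_smul G x)
  mul_smul g h x := by
    induction x using Quotient.inductionOn with | _ x
    exact congrArg _ (mul_smul g h x)

theorem hasFiveColorings_of_derivedSeries {G : Type*} [Group G] [Finite G] (n : ℕ) :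
    ∀ (Ω : Type*) [MulAction G Ω] [Nonempty Ω], (∀ g ∈ derivedSeries G n, ∀ x : Ω, g • x = x) →
      HasFiveColorings G (Set.univ : Set Ω) := by
  induction n with
  | zero =>
    intro Ω _ _ h
    exact ⟨fun i _ => i, fun i j g _ hij =>
      ⟨hij (Classical.arbitrary Ω) (Set.mem_univ _), fun x _ => h g (by simp) x⟩⟩
  | succ n ih =>
    intro Ω _ _ h
    let N := derivedSeries G n
    let := orbitsMulAction Ω N
    have : Nonempty (MulAction.orbitRel.Quotient N Ω) :=
      ⟨Quotient.mk _ (Classical.arbitrary Ω)⟩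
    refine hasFiveColorings_of_fibers (Ω := MulAction.orbitRel.Quotient N Ω)
      (π := Quotient.mk _) (fun _ _ => rfl) (ih _ ?_) fun ω => ?_
    · intro g hg x
      induction x using Quotient.inductionOn with | _ x
      exact Quotient.sound ⟨⟨g, hg⟩, rfl⟩
    · induction ω using Quotient.inductionOn with | _ p
      have hcomm : ∀ a b : N, ∀ x : Ω, (a * b) • x = (b * a) • x := by
        intro a b x
        have hc : (a : G)⁻¹ * (b : G)⁻¹ * (a : G)⁻¹⁻¹ * (b : G)⁻¹⁻¹ ∈ derivedSeries G (n + 1) :=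
          Subgroup.commutator_mem_commutator (inv_mem a.2) (inv_mem b.2)
        have hx := h _ hc x
        change ((a : G) * b) • x = ((b : G) * a) • x
        conv_rhs => rw [← hx]
        rw [← mul_smul]
        congr 1
        group
      have hS : Quotient.mk (MulAction.orbitRel N Ω) ⁻¹' {⟦p⟧} = MulAction.orbit N p := by
        ext x
        exact Quotient.eq (r := MulAction.orbitRel N Ω)
      rw [hS]
      exact hasFiveColorings_orbit N hcomm p

/-- **Theorem (Seress).** A solvable permutation group `R ≤ Sym(Δ)` on a finite set has
distinguishing number at most 5: there is a colouring of `Δ` with 5 colours preserved by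
no nontrivial element of `R`. -/
theorem distinguishing_number_le_five_of_solvable
    (Δ : Type) [Fintype Δ] (R : Subgroup (Equiv.Perm Δ)) (hR : IsSolvable ↥R) :
    ∃ f : Δ → Fin 5, ∀ g ∈ R, (∀ δ : Δ, f (g δ) = f δ) → g = 1 := by
  obtain ⟨n, hn⟩ := hR.solvable
  rcases isEmpty_or_nonempty Δ with hΔ | hΔ
  · exact ⟨fun _ => 0, fun g _ _ => Subsingleton.elim _ _⟩
  · obtain ⟨F, hF⟩ := hasFiveColorings_of_derivedSeries (G := R) n Δ (by
      intro g hg x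
      rw [hn, Subgroup.mem_bot] at hg
      rw [hg, one_smul])
    refine ⟨F 0, fun g hg h => Equiv.ext fun x => ?_⟩
    exact (hF 0 0 ⟨g, hg⟩ (fun _ => by simp) fun x _ => h x).2 x (Set.mem_univ _)
end
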